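/- arXiv:math/0608189 — 3 statements merged into one kernel-verified Lean document; each statement's English description precedes it below -/
import Mathlib

section
/- Assume K satisfies (K1), f satisfies (f1) and (f2), and additionally f is C¹ on [u₀,∞). For α>u₀ let r₀(α) denote the first r with u(r,α)=u₀ (r₀(α)=R(α) taken as the right endpoint if u(·,α) never reaches u₀). Then the functions (r,α) ↦ u(r,α) and (r,α) ↦ r^{n-1}φ_p(u'(r,α)) are C¹ on the set O = {(r,α) : α>u₀, 0 ≤ r < r₀(α)}. Moreover, setting φ(r,α) = ∂u/∂α(r,α), one has: φ(0,α)=1; ∂u'/∂α(r,α) = ∂φ/∂r(r,α) =: φ'(r,α) for 0<r<r₀(α); lim_{r→0⁺} r^{n-1}|u'(r,α)|^{p-2}φ'(r,α) = 0; and φ satisfies the linearized equation (p-1)·(r^{n-1}|u'(r,α)|^{p-2}φ'(r,α))' + r^{n-1}K(r)f'(u(r,α))φ(r,α) = 0 for 0<r<r₀(α). Finally, if r₀(α)<∞ then φ(·,α) and r^{n-1}|u'(·,α)|^{p-2}φ'(·,α) extend continuously to [0,r₀(α)], the extension of φ' being the left derivative of φ at r₀(α). -/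
open Set Filter Topology MeasureTheory
open scoped ENNReal NNReal

noncomputable section

/-- `φ_p(s) = |s|^{p-2} s` (with the convention `φ_p(0)=0`). -/
def phiP (p s : ℝ) : ℝ := |s| ^ (p - 2) * s

/-- `K` is strictly positive and `C¹` on `(0,∞)` and satisfies condition (K1):
the map `r ↦ p + r·K'(r)/K(r)` is strictly positive and decreasing on `(0,∞)`. -/
def CondK1 (p : ℝ) (K : ℝ → ℝ) : Prop :=
  (∀ r : ℝ, 0 < r → 0 < K r) ∧ ContDiffOn ℝ 1 K (Ioi 0) ∧
  (∀ r : ℝ, 0 < r → 0 < p + r * deriv K r / K r) ∧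
  AntitoneOn (fun r => p + r * deriv K r / K r) (Ioi 0)

/-- (f1): `f(0)=0`, `f>0` above `u₀`, `f≤0` and not identically `0` on `(0,u₀)`. -/
def CondF1 (f : ℝ → ℝ) (u₀ : ℝ) : Prop :=
  f 0 = 0 ∧ (∀ v : ℝ, u₀ < v → 0 < f v) ∧ (∀ v ∈ Ioo 0 u₀, f v ≤ 0) ∧
  ∃ v ∈ Ioo 0 u₀, f v ≠ 0

/-- (f2): `f` is continuous on `[0,∞)` and locally Lipschitz on `[u₀,∞)`. -/
def CondF2 (f : ℝ → ℝ) (u₀ : ℝ) : Prop :=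
  ContinuousOn f (Ici 0) ∧ LocallyLipschitzOn (Ici u₀) f

/-- `D`: the set of differentiability points of `f` within `[u₀,∞)`. -/
def Dset (f : ℝ → ℝ) (u₀ : ℝ) : Set ℝ :=
  {v | v ∈ Ici u₀ ∧ DifferentiableWithinAt ℝ f (Ici u₀) v}

/-- the (one-sided) derivative `f'` of `f` on `[u₀,∞)`. -/
def fder (f : ℝ → ℝ) (u₀ : ℝ) (v : ℝ) : ℝ := derivWithin f (Ici u₀) v

/-- (f3): `(p-1)f(u) ≤ f'(u)(u-u₀)` on `D`. -/
def CondF3 (p : ℝ) (f : ℝ → ℝ) (u₀ : ℝ) : Prop :=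
  ∀ v ∈ Dset f u₀, (p - 1) * f v ≤ fder f u₀ v * (v - u₀)

/-- (f4): `u ↦ u·f'(u)/f(u)` is decreasing on `D`. -/
def CondF4 (f : ℝ → ℝ) (u₀ : ℝ) : Prop :=
  AntitoneOn (fun v => v * fder f u₀ v / f v) (Dset f u₀)

/-- `u` is a solution of the radial equation
`(r^{n-1} φ_p(u'))' = -r^{n-1} K(r) f(u)` on the interval `I ⊆ [0,∞)`, `0 ∈ I`:
`u ∈ C¹(I)`, `r ↦ r^{n-1} φ_p(u'(r))` is `C¹` on `I` and the equation holds for `r ∈ I`, `r>0`. -/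
def IsRadialSolution (p : ℝ) (n : ℕ) (K f : ℝ → ℝ) (I : Set ℝ) (u : ℝ → ℝ) : Prop :=
  (0:ℝ) ∈ I ∧ I ⊆ Ici 0 ∧
  ContDiffOn ℝ 1 u I ∧
  ContDiffOn ℝ 1 (fun r => r ^ (n - 1) * phiP p (derivWithin u I r)) I ∧
  ∀ r ∈ I, 0 < r →
    HasDerivWithinAt (fun r => r ^ (n - 1) * phiP p (derivWithin u I r))
      (-(r ^ (n - 1) * K r * f (u r))) I r

/-- `F(s) = ∫₀^s f(t) dt`. -/
def Fint (f : ℝ → ℝ) (s : ℝ) : ℝ := ∫ t in (0:ℝ)..s, f t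

/-- the derivative `u'` of a solution defined on `[0,∞)` (one-sided at `0`). -/
def uderiv (u : ℝ → ℝ) : ℝ → ℝ := derivWithin u (Ici 0)

/-- `R(α) = sup {r>0 : u(t,α)>0 and u'(t,α)<0 for all t ∈ (0,r)}`,
as an extended nonnegative real (it may be `∞`). -/
def Rend (u : ℝ → ℝ) : ℝ≥0∞ :=
  sSup {R : ℝ≥0∞ | ∀ t : ℝ, 0 < t → ENNReal.ofReal t < R → 0 < u t ∧ uderiv u t < 0}

/-- the filter describing the approach `r → R⁻` to the right endpoint `R`
(`r → ∞` when `R = ∞`). -/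
def endFilter (R : ℝ≥0∞) : Filter ℝ :=
  if R = ⊤ then atTop else 𝓝[<] R.toReal

/-- `u : α ↦ u(·,α)` is the family of solutions of the initial value problems
(`u(0,α)=α`, `u'(0,α)=0`) for `α > u₀`, depending continuously on `(α,r)`
together with its derivative. -/
def IsFamily (p : ℝ) (n : ℕ) (K f : ℝ → ℝ) (u₀ : ℝ) (u : ℝ → ℝ → ℝ) : Prop :=
  (∀ α : ℝ, u₀ < α →
    IsRadialSolution p n K f (Ici 0) (u α) ∧ u α 0 = α ∧ uderiv (u α) 0 = 0) ∧
  ContinuousOn (fun q : ℝ × ℝ => u q.1 q.2) (Ioi u₀ ×ˢ Ici 0) ∧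
  ContinuousOn (fun q : ℝ × ℝ => uderiv (u q.1) q.2) (Ioi u₀ ×ˢ Ici 0)

/-- the set `N` of initial values of crossing solutions; here `uR α` denotes the
limiting value `u(R(α),α)`. -/
def Ncross (u : ℝ → ℝ → ℝ) (uR : ℝ → ℝ) (u₀ : ℝ) : Set ℝ :=
  {α | u₀ < α ∧ uR α = 0 ∧
    ∃ L : ℝ, L < 0 ∧ Tendsto (uderiv (u α)) (endFilter (Rend (u α))) (𝓝 L)}

/-- the set `G` of initial values of ground state solutions. -/
def Gset (u : ℝ → ℝ → ℝ) (uR : ℝ → ℝ) (u₀ : ℝ) : Set ℝ :=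
  {α | u₀ < α ∧ uR α = 0 ∧
    Tendsto (uderiv (u α)) (endFilter (Rend (u α))) (𝓝 0)}

/-- the set `P` of initial values of positive solutions. -/
def Pset (uR : ℝ → ℝ) (u₀ : ℝ) : Set ℝ := {α | u₀ < α ∧ 0 < uR α}

/-- `t(s,α)`: the first point at which the solution `u(·,α)` takes the value `s`
(the unique `r ∈ [0,R(α))` with `u(r,α)=s` when `s` is attained there). -/
def tInv (u : ℝ → ℝ) (s : ℝ) : ℝ := sInf {r : ℝ | 0 ≤ r ∧ u r = s}

/-- the region `O = {(α,r) : α > u₀, 0 ≤ r < r₀(α)}` (here `q.1 = α`, `q.2 = r`);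
for `r ∈ [0,R(α))` one has `r < r₀(α)` exactly when `u(r,α) > u₀`. -/
def Oset (u : ℝ → ℝ → ℝ) (u₀ : ℝ) : Set (ℝ × ℝ) :=
  {q | u₀ < q.1 ∧ 0 ≤ q.2 ∧ ENNReal.ofReal q.2 < Rend (u q.1) ∧ u₀ < u q.1 q.2}

/-- The iterated integral operator `η ↦ ∫₀^r B(s) ∫₀^s κ(t) η(t) dt ds`. -/
def volterra (B κ η : ℝ → ℝ) (r : ℝ) : ℝ :=
  ∫ s in (0:ℝ)..r, B s * ∫ t in (0:ℝ)..s, κ t * η t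

/-- Conditions on `B` (possibly singular at `0`) and `κ` making `volterra B κ` a bounded
operator on `C[0,R]`. -/
structure IsVolterraKernel (R C : ℝ) (B κ : ℝ → ℝ) : Prop where
  continuousOn_inner : ContinuousOn κ (Icc 0 R)
  continuousOn_outer : ContinuousOn B (Ioc 0 R)
  bound : ∀ s ∈ Ioc 0 R, |B s| * ∫ t in (0:ℝ)..s, |κ t| ≤ C

theorem ContinuousOn.intervalIntegrable_of_mem_Icc {h : ℝ → ℝ} {R r : ℝ}
    (hh : ContinuousOn h (Icc 0 R)) (hr : r ∈ Icc 0 R) : IntervalIntegrable h volume 0 r :=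
  (hh.mono (Icc_subset_Icc_right hr.2)).intervalIntegrable_of_Icc hr.1

namespace IsVolterraKernel

variable {R C : ℝ} {B κ η : ℝ → ℝ}

theorem mono (hk : IsVolterraKernel R C B κ) {R' : ℝ} (h : R' ≤ R) :
    IsVolterraKernel R' C B κ where
  continuousOn_inner := hk.continuousOn_inner.mono (Icc_subset_Icc_right h)
  continuousOn_outer := hk.continuousOn_outer.mono (Ioc_subset_Ioc_right h)
  bound s hs := hk.bound s ⟨hs.1, hs.2.trans h⟩

theorem abs_inner_le (hk : IsVolterraKernel R C B κ) {s N : ℝ} (hs : s ∈ Icc 0 R)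
    (hη : ∀ t ∈ Icc 0 s, |η t| ≤ N) :
    |∫ t in (0:ℝ)..s, κ t * η t| ≤ (∫ t in (0:ℝ)..s, |κ t|) * N := by
  rw [← intervalIntegral.integral_mul_const, ← Real.norm_eq_abs]
  refine intervalIntegral.norm_integral_le_of_norm_le hs.1 (ae_of_all _ fun t ht => ?_) ?_
  · rw [Real.norm_eq_abs, abs_mul]
    exact mul_le_mul_of_nonneg_left (hη t ⟨ht.1.le, ht.2⟩) (abs_nonneg _)
  · exact ((hk.continuousOn_inner.abs).intervalIntegrable_of_mem_Icc hs).mul_const N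

theorem abs_integrand_le (hk : IsVolterraKernel R C B κ) {s N : ℝ} (hs : s ∈ Ioc 0 R)
    (hη : ∀ t ∈ Icc 0 s, |η t| ≤ N) :
    |B s * ∫ t in (0:ℝ)..s, κ t * η t| ≤ C * N := by
  have hN : 0 ≤ N := (abs_nonneg _).trans (hη 0 ⟨le_rfl, hs.1.le⟩)
  rw [abs_mul]
  calc |B s| * |∫ t in (0:ℝ)..s, κ t * η t|
      ≤ |B s| * ((∫ t in (0:ℝ)..s, |κ t|) * N) :=
        mul_le_mul_of_nonneg_left (hk.abs_inner_le ⟨hs.1.le, hs.2⟩ hη) (abs_nonneg _)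
    _ = (|B s| * ∫ t in (0:ℝ)..s, |κ t|) * N := by ring
    _ ≤ C * N := mul_le_mul_of_nonneg_right (hk.bound s hs) hN

theorem continuousOn_primitive (hk : IsVolterraKernel R C B κ) (hη : ContinuousOn η (Icc 0 R)) :
    ContinuousOn (fun s => ∫ t in (0:ℝ)..s, κ t * η t) (Icc 0 R) := by
  rcases le_or_gt 0 R with hR | hR
  · rw [← uIcc_of_le hR]
    apply intervalIntegral.continuousOn_primitive_interval
    rw [uIcc_of_le hR]
    exact (hk.continuousOn_inner.mul hη).integrableOn_Icc
  · simp [Icc_eq_empty_of_lt hR]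

theorem continuousOn_integrand (hk : IsVolterraKernel R C B κ) (hη : ContinuousOn η (Icc 0 R)) :
    ContinuousOn (fun s => B s * ∫ t in (0:ℝ)..s, κ t * η t) (Ioc 0 R) :=
  hk.continuousOn_outer.mul ((hk.continuousOn_primitive hη).mono Ioc_subset_Icc_self)

theorem exists_abs_le (hη : ContinuousOn η (Icc 0 R)) : ∃ N, ∀ t ∈ Icc 0 R, |η t| ≤ N :=
  isCompact_Icc.exists_bound_of_continuousOn hη

theorem integrableOn_integrand (hk : IsVolterraKernel R C B κ) (hη : ContinuousOn η (Icc 0 R)) :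
    IntegrableOn (fun s => B s * ∫ t in (0:ℝ)..s, κ t * η t) (Ioc 0 R) := by
  obtain ⟨N, hN⟩ := exists_abs_le hη
  have hm := (hk.continuousOn_integrand hη).aestronglyMeasurable (μ := volume) measurableSet_Ioc
  refine IntegrableOn.of_bound (C := C * N) (by simp) hm ?_
  filter_upwards [self_mem_ae_restrict measurableSet_Ioc] with s hs
  exact hk.abs_integrand_le hs fun t ht => hN t ⟨ht.1, ht.2.trans hs.2⟩

theorem intervalIntegrable_integrand (hk : IsVolterraKernel R C B κ)
    (hη : ContinuousOn η (Icc 0 R)) {r : ℝ} (hr : r ∈ Icc 0 R) :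
    IntervalIntegrable (fun s => B s * ∫ t in (0:ℝ)..s, κ t * η t) volume 0 r := by
  rw [intervalIntegrable_iff_integrableOn_Ioc_of_le hr.1]
  exact (hk.integrableOn_integrand hη).mono_set (Ioc_subset_Ioc_right hr.2)

theorem continuousOn_volterra (hk : IsVolterraKernel R C B κ) (hη : ContinuousOn η (Icc 0 R)) :
    ContinuousOn (volterra B κ η) (Icc 0 R) := by
  rcases le_or_gt 0 R with hR | hR
  · rw [← uIcc_of_le hR]
    apply intervalIntegral.continuousOn_primitive_interval
    rw [uIcc_of_le hR, integrableOn_Icc_iff_integrableOn_Ioc]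
    exact hk.integrableOn_integrand hη
  · simp [Icc_eq_empty_of_lt hR]

theorem inner_lincomb (hk : IsVolterraKernel R C B κ) {ξ : ℝ → ℝ}
    (hη : ContinuousOn η (Icc 0 R)) (hξ : ContinuousOn ξ (Icc 0 R)) (c : ℝ) {s : ℝ}
    (hs : s ∈ Icc 0 R) :
    ∫ t in (0:ℝ)..s, κ t * (η t - c * ξ t) =
      (∫ t in (0:ℝ)..s, κ t * η t) - c * ∫ t in (0:ℝ)..s, κ t * ξ t := by
  rw [← intervalIntegral.integral_const_mul, ← intervalIntegral.integral_sub]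
  · congr 1; ext t; ring
  · exact (hk.continuousOn_inner.mul hη).intervalIntegrable_of_mem_Icc hs
  · exact ((hk.continuousOn_inner.mul hξ).intervalIntegrable_of_mem_Icc hs).const_mul c

theorem volterra_lincomb (hk : IsVolterraKernel R C B κ) {ξ : ℝ → ℝ}
    (hη : ContinuousOn η (Icc 0 R)) (hξ : ContinuousOn ξ (Icc 0 R)) (c : ℝ) {r : ℝ}
    (hr : r ∈ Icc 0 R) :
    volterra B κ (fun t => η t - c * ξ t) r = volterra B κ η r - c * volterra B κ ξ r := by
  unfold volterra
  rw [← intervalIntegral.integral_const_mul, ← intervalIntegral.integral_sub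
    (hk.intervalIntegrable_integrand hη hr)
    ((hk.intervalIntegrable_integrand hξ hr).const_mul c)]
  refine intervalIntegral.integral_congr fun s hs => ?_
  rw [uIcc_of_le hr.1] at hs
  simp only
  rw [hk.inner_lincomb hη hξ c ⟨hs.1, hs.2.trans hr.2⟩]
  ring

theorem abs_volterra_le_exp (hk : IsVolterraKernel R C B κ) (hC : 0 ≤ C) {N l : ℝ} (hN : 0 ≤ N)
    (hl : 2 * C + 1 ≤ l) {r : ℝ} (hr : r ∈ Icc 0 R)
    (hη : ∀ t ∈ Icc 0 R, |η t| ≤ N * Real.exp (l * t)) :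
    |volterra B κ η r| ≤ N * Real.exp (l * r) / 2 := by
  have hl0 : 0 < l := by linarith
  have h1 : |volterra B κ η r| ≤ ∫ s in (0:ℝ)..r, C * N * Real.exp (l * s) := by
    rw [volterra, ← Real.norm_eq_abs]
    refine intervalIntegral.norm_integral_le_of_norm_le hr.1 (ae_of_all _ fun s hs => ?_) ?_
    · rw [Real.norm_eq_abs, mul_assoc]
      refine hk.abs_integrand_le ⟨hs.1, hs.2.trans hr.2⟩ fun t ht => ?_
      refine (hη t ⟨ht.1, ht.2.trans (hs.2.trans hr.2)⟩).trans ?_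
      gcongr
      exact ht.2
    · exact Continuous.intervalIntegrable (by fun_prop) _ _
  have h2 : ∫ s in (0:ℝ)..r, C * N * Real.exp (l * s) =
      C * N * Real.exp (l * r) / l - C * N / l := by
    rw [intervalIntegral.integral_eq_sub_of_hasDerivAt
      (f := fun s => C * N * Real.exp (l * s) / l)]
    · simp
    · intro x _
      have := (((hasDerivAt_id x).const_mul l).exp.const_mul (C * N)).div_const l
      refine this.congr_deriv ?_
      simp only [id]
      field_simp
    · exact Continuous.intervalIntegrable (by fun_prop) _ _
  have h3 : 0 ≤ C * N / l := by positivity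
  have h4 : C * N * Real.exp (l * r) / l ≤ N * Real.exp (l * r) / 2 := by
    rw [div_le_div_iff₀ hl0 two_pos]
    have : 0 ≤ N * Real.exp (l * r) := by positivity
    nlinarith
  linarith

/-- Gronwall-type estimate for the equation `η + volterra B κ η = O(ε)`. -/
theorem abs_le_of_abs_add_volterra_le (hk : IsVolterraKernel R C B κ) (hC : 0 ≤ C)
    (hη : ContinuousOn η (Icc 0 R)) {ε : ℝ}
    (h : ∀ r ∈ Icc 0 R, |η r + volterra B κ η r| ≤ ε) :
    ∀ r ∈ Icc 0 R, |η r| ≤ 2 * ε * Real.exp ((2 * C + 1) * R) := by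
  intro r hr
  have hR : 0 ≤ R := hr.1.trans hr.2
  set l := 2 * C + 1 with hl
  obtain ⟨t₀, ht₀, hmax⟩ := isCompact_Icc.exists_isMaxOn (nonempty_Icc.2 hR)
    (f := fun t => |η t| * Real.exp (-(l * t)))
    (hη.abs.mul (Continuous.continuousOn (by fun_prop)))
  set N := |η t₀| * Real.exp (-(l * t₀)) with hNdef
  have hN : 0 ≤ N := by positivity
  have hbound : ∀ t ∈ Icc 0 R, |η t| ≤ N * Real.exp (l * t) := by
    intro t ht
    have h1 : |η t| * Real.exp (-(l * t)) ≤ N := hmax ht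
    have h2 := mul_le_mul_of_nonneg_right h1 (Real.exp_pos (l * t)).le
    rwa [mul_assoc, ← Real.exp_add, neg_add_cancel, Real.exp_zero, mul_one] at h2
  have hε : 0 ≤ ε := (abs_nonneg _).trans (h r hr)
  have h3 := hk.abs_volterra_le_exp hC hN le_rfl ht₀ hbound
  have h4 : |η t₀| = N * Real.exp (l * t₀) := by
    rw [hNdef, mul_assoc, ← Real.exp_add, neg_add_cancel, Real.exp_zero, mul_one]
  have h5 : |η t₀| ≤ |η t₀ + volterra B κ η t₀| + |volterra B κ η t₀| := by
    simpa using abs_sub (η t₀ + volterra B κ η t₀) (volterra B κ η t₀)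
  have h6 : N * Real.exp (l * t₀) ≤ 2 * ε := by
    have := h t₀ ht₀
    rw [← hl] at h3
    linarith
  have h7 : 1 ≤ Real.exp (l * t₀) := Real.one_le_exp (mul_nonneg (by positivity) ht₀.1)
  have h8 : N ≤ 2 * ε := (le_mul_of_one_le_right hN h7).trans h6
  calc |η r| ≤ N * Real.exp (l * r) := hbound r hr
    _ ≤ 2 * ε * Real.exp (l * R) := by
      gcongr
      exact hr.2

/-- The linear equation `Φ + volterra B κ Φ = 1` has a continuous solution. -/
theorem exists_solution (hk : IsVolterraKernel R C B κ) (hC : 0 ≤ C) (hR : 0 ≤ R) :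
    ∃ Φ : ℝ → ℝ, ContinuousOn Φ (Icc 0 R) ∧ ∀ r ∈ Icc 0 R, Φ r = 1 - volterra B κ Φ r := by
  set l := 2 * C + 1 with hl
  let E : C(Icc 0 R, ℝ) → ℝ → ℝ := fun x t => Real.exp (l * t) * IccExtend hR x t
  have hE : ∀ x, ContinuousOn (E x) (Icc 0 R) := fun x =>
    ((by fun_prop : Continuous fun t : ℝ => Real.exp (l * t)).mul
      (x.continuous.Icc_extend')).continuousOn
  let T : C(Icc 0 R, ℝ) → C(Icc 0 R, ℝ) := fun x =>
    ⟨fun r => Real.exp (-(l * r)) * (1 - volterra B κ (E x) r),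
      (by fun_prop : Continuous fun r : Icc 0 R => Real.exp (-(l * (r : ℝ)))).mul
        (continuous_const.sub
          (continuousOn_iff_continuous_domRestrict.1 (hk.continuousOn_volterra (hE x))))⟩
  have hT : ContractingWith (1 / 2 : ℝ≥0) T := by
    refine ⟨by rw [← NNReal.coe_lt_coe]; norm_num, LipschitzWith.of_dist_le_mul fun x y => ?_⟩
    rw [ContinuousMap.dist_le (by positivity)]
    intro r
    have hdiff : ∀ t ∈ Icc 0 R, |E x t - 1 * E y t| ≤ dist x y * Real.exp (l * t) := by
      intro t ht
      simp only [E, IccExtend_of_mem hR _ ht, one_mul]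
      rw [← mul_sub, abs_mul, abs_of_pos (Real.exp_pos _), mul_comm]
      exact mul_le_mul_of_nonneg_right (ContinuousMap.dist_apply_le_dist (f := x) (g := y) ⟨t, ht⟩)
        (Real.exp_pos _).le
    have h1 := hk.abs_volterra_le_exp hC dist_nonneg le_rfl r.2 hdiff
    rw [hk.volterra_lincomb (hE x) (hE y) 1 r.2] at h1
    have h2 : dist (T x r) (T y r) =
        Real.exp (-(l * r)) * |volterra B κ (E x) r - 1 * volterra B κ (E y) r| := by
      rw [Real.dist_eq, ← abs_of_pos (Real.exp_pos (-(l * (r : ℝ)))), ← abs_mul, abs_sub_comm]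
      simp only [T, ContinuousMap.coe_mk]
      congr 1; ring
    rw [h2]
    calc _ ≤ Real.exp (-(l * r)) * (dist x y * Real.exp (l * r) / 2) :=
          mul_le_mul_of_nonneg_left h1 (Real.exp_pos _).le
      _ = (Real.exp (-(l * r)) * Real.exp (l * r)) * (dist x y / 2) := by ring
      _ = _ := by
        rw [← Real.exp_add, neg_add_cancel, Real.exp_zero]
        push_cast; ring
  obtain ⟨x, hx⟩ : ∃ x, T x = x := ⟨hT.fixedPoint T, hT.fixedPoint_isFixedPt⟩
  refine ⟨E x, hE x, fun r hr => ?_⟩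
  have h1 : Real.exp (-(l * r)) * (1 - volterra B κ (E x) r) = x ⟨r, hr⟩ :=
    congrArg (fun y : C(Icc 0 R, ℝ) => y ⟨r, hr⟩) hx
  have h2 : E x r = Real.exp (l * r) * x ⟨r, hr⟩ := by simp only [E, IccExtend_of_mem hR _ hr]
  rw [h2, ← h1, ← mul_assoc, ← Real.exp_add, add_neg_cancel, Real.exp_zero, one_mul]

end IsVolterraKernel

/-- A `C¹` function is strictly differentiable uniformly on compact sets. -/
theorem IsCompact.exists_uniform_strict_deriv {F F' : ℝ → ℝ} {S U : Set ℝ} (hS : IsCompact S)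
    (hU : IsOpen U) (hSU : S ⊆ U) (hF : ∀ x ∈ U, HasStrictDerivAt F (F' x) x)
    (hF' : ContinuousOn F' U) {ε : ℝ} (hε : 0 < ε) :
    ∃ δ > 0, ∀ x ∈ S, ∀ y z : ℝ, |y - x| < δ → |z - x| < δ →
      |F y - F z - F' x * (y - z)| ≤ ε * |y - z| := by
  have key : ∀ᶠ d : ℝ × ℝ in 𝓝 (0, 0), ∀ x ∈ S,
      |F (x + d.1) - F (x + d.2) - F' x * ((x + d.1) - (x + d.2))| ≤
        ε * |(x + d.1) - (x + d.2)| := by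
    refine hS.eventually_forall_of_forall_eventually fun x₀ hx₀ => ?_
    have h1 := (hF x₀ (hSU hx₀)).isLittleO.def (half_pos hε)
    have h2 : Tendsto (fun z : (ℝ × ℝ) × ℝ => (z.2 + z.1.1, z.2 + z.1.2))
        (𝓝 ((0, 0), x₀)) (𝓝 (x₀, x₀)) := by
      have : Continuous (fun z : (ℝ × ℝ) × ℝ => (z.2 + z.1.1, z.2 + z.1.2)) := by fun_prop
      simpa using this.tendsto ((0, 0), x₀)
    have h3 : ∀ᶠ z : (ℝ × ℝ) × ℝ in 𝓝 ((0, 0), x₀), |F' z.2 - F' x₀| < ε / 2 := by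
      have hc : ContinuousAt F' x₀ := hF'.continuousAt (hU.mem_nhds (hSU hx₀))
      have h4 : Tendsto (fun z : (ℝ × ℝ) × ℝ => z.2) (𝓝 ((0, 0), x₀)) (𝓝 x₀) :=
        continuous_snd.tendsto _
      exact (hc.tendsto.comp h4).eventually (Metric.ball_mem_nhds _ (half_pos hε))
    filter_upwards [h2.eventually h1, h3] with z hz1 hz3
    simp only [Real.norm_eq_abs, ContinuousLinearMap.toSpanSingleton_apply, smul_eq_mul] at hz1
    set y := z.2 + z.1.1
    set w := z.2 + z.1.2
    calc |F y - F w - F' z.2 * (y - w)|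
        = |(F y - F w - (y - w) * F' x₀) - (F' z.2 - F' x₀) * (y - w)| := by congr 1; ring
      _ ≤ |F y - F w - (y - w) * F' x₀| + |F' z.2 - F' x₀| * |y - w| := by
        rw [← abs_mul]; exact abs_sub _ _
      _ ≤ ε / 2 * |y - w| + ε / 2 * |y - w| :=
        add_le_add hz1 (mul_le_mul_of_nonneg_right hz3.le (abs_nonneg _))
      _ = ε * |y - w| := by ring
  obtain ⟨δ, hδ, hball⟩ := Metric.eventually_nhds_iff.1 key
  refine ⟨δ, hδ, fun x hx y z hy hz => ?_⟩
  have := hball (y := (y - x, z - x)) (by simp [Prod.dist_eq, hy, hz]) x hx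
  simpa using this

theorem abs_phiP {p : ℝ} (hp : 1 < p) (s : ℝ) : |phiP p s| = |s| ^ (p - 1) := by
  rcases eq_or_ne s 0 with rfl | hs
  · simp [phiP, Real.zero_rpow (by linarith : p - 1 ≠ 0)]
  · rw [phiP, abs_mul, abs_of_nonneg (Real.rpow_nonneg (abs_nonneg s) _),
      ← Real.rpow_add_one (abs_ne_zero.2 hs)]
    congr 1; ring

theorem eq_of_phiP_eq_neg {p s m : ℝ} (hp : 1 < p) (hm : 0 < m) (h : phiP p s = -m) :
    s = -m ^ (1 / (p - 1)) := by
  have hs : s < 0 := by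
    by_contra! hs
    have : 0 ≤ phiP p s := mul_nonneg (Real.rpow_nonneg (abs_nonneg s) _) hs
    linarith
  have h1 : |s| ^ (p - 1) = m := by rw [← abs_phiP hp, h, abs_neg, abs_of_pos hm]
  rw [← h1, ← Real.rpow_mul (abs_nonneg s), mul_one_div_cancel (by linarith), Real.rpow_one,
    abs_of_neg hs, neg_neg]

/-- The weight `r^{n-1} K(r)` of the equation. -/
def weight (n : ℕ) (K : ℝ → ℝ) (r : ℝ) : ℝ := r ^ (n - 1) * K r

/-- The flux `r^{n-1} φ_p(u'(r))`. -/
def flux (p : ℝ) (n : ℕ) (v : ℝ → ℝ) (r : ℝ) : ℝ := r ^ (n - 1) * phiP p (uderiv v r)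

/-- `∫₀^r t^{n-1} K(t) f(v(t)) dt`. -/
def mass (n : ℕ) (K f v : ℝ → ℝ) (r : ℝ) : ℝ := ∫ t in (0:ℝ)..r, weight n K t * f (v t)

/-- The inner coefficient `r^{n-1} K(r) f'(v(r))` of the linearized equation. -/
def linInner (n : ℕ) (K f : ℝ → ℝ) (u₀ : ℝ) (v : ℝ → ℝ) (r : ℝ) : ℝ :=
  weight n K r * fder f u₀ (v r)

/-- The outer coefficient of the linearized equation in integrated form; away from `0` it is the
reciprocal of `(p-1) r^{n-1} |v'(r)|^{p-2}`. -/
def linOuter (p : ℝ) (n : ℕ) (K f v : ℝ → ℝ) (r : ℝ) : ℝ :=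
  1 / (p - 1) * |uderiv v r| / mass n K f v r

/-- Standing assumptions on the data together with a global solution `v` with `v(0) = α`,
`v'(0) = 0`. -/
structure RadialIVP (p : ℝ) (n : ℕ) (K f : ℝ → ℝ) (u₀ α : ℝ) (v : ℝ → ℝ) : Prop where
  one_lt : 1 < p
  lt_dim : p < n
  K_pos : ∀ r, 0 < r → 0 < K r
  K_cont : ContinuousOn K (Ioi 0)
  f_pos : ∀ x, u₀ < x → 0 < f x
  f_contDiff : ContDiffOn ℝ 1 f (Ici u₀)
  lt_init : u₀ < α
  sol : IsRadialSolution p n K f (Ici 0) v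
  init : v 0 = α
  init_deriv : uderiv v 0 = 0

theorem hasStrictDerivAt_of_contDiffOn_Ici {f : ℝ → ℝ} {u₀ : ℝ} (hf : ContDiffOn ℝ 1 f (Ici u₀))
    {x : ℝ} (hx : x ∈ Ioi u₀) : HasStrictDerivAt f (fder f u₀ x) x := by
  have := (hf.contDiffAt (Ici_mem_nhds hx)).hasStrictDerivAt one_ne_zero
  rwa [← derivWithin_of_mem_nhds (Ici_mem_nhds hx)] at this

namespace RadialIVP

variable {p : ℝ} {n : ℕ} {K f : ℝ → ℝ} {u₀ α : ℝ} {v : ℝ → ℝ}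

section

variable (h : RadialIVP p n K f u₀ α v)
include h

theorem two_le_dim : 2 ≤ n := by
  have : (1 : ℝ) < n := h.one_lt.trans h.lt_dim
  exact_mod_cast this

theorem f_cont : ContinuousOn f (Ici u₀) := h.f_contDiff.continuousOn

theorem fder_cont : ContinuousOn (fder f u₀) (Ici u₀) :=
  h.f_contDiff.continuousOn_derivWithin (uniqueDiffOn_Ici u₀) le_rfl

theorem cont : ContinuousOn v (Ici 0) := h.sol.2.2.1.continuousOn

theorem uderiv_cont : ContinuousOn (uderiv v) (Ici 0) :=
  h.sol.2.2.1.continuousOn_derivWithin (uniqueDiffOn_Ici 0) le_rfl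

theorem hasDerivWithinAt {r : ℝ} (hr : 0 ≤ r) : HasDerivWithinAt v (uderiv v r) (Ici 0) r :=
  (h.sol.2.2.1.differentiableOn one_ne_zero r hr).hasDerivWithinAt

theorem hasDerivAt {r : ℝ} (hr : 0 < r) : HasDerivAt v (uderiv v r) r :=
  (h.hasDerivWithinAt hr.le).hasDerivAt (Ici_mem_nhds hr)

theorem weight_zero : weight n K 0 = 0 := by
  have := h.two_le_dim
  simp [weight, zero_pow (by omega : n - 1 ≠ 0)]

theorem flux_zero : flux p n v 0 = 0 := by
  have := h.two_le_dim
  simp [flux, zero_pow (by omega : n - 1 ≠ 0)]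

theorem weight_pos {r : ℝ} (hr : 0 < r) : 0 < weight n K r := mul_pos (pow_pos hr _) (h.K_pos r hr)

theorem weight_nonneg {r : ℝ} (hr : 0 ≤ r) : 0 ≤ weight n K r := by
  rcases hr.eq_or_lt with rfl | hr
  · exact h.weight_zero.ge
  · exact (h.weight_pos hr).le

theorem flux_hasDerivWithinAt_zero : HasDerivWithinAt (flux p n v) 0 (Ici 0) 0 := by
  have hn := h.two_le_dim
  rw [hasDerivWithinAt_iff_tendsto_slope, Ici_sdiff_left]
  have h1 : Tendsto (fun r : ℝ => r ^ (n - 2) * phiP p (uderiv v r)) (𝓝[>] 0) (𝓝 0) := by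
    have h2 : Tendsto (fun r : ℝ => phiP p (uderiv v r)) (𝓝[>] 0) (𝓝 0) := by
      rw [tendsto_zero_iff_abs_tendsto_zero]
      have h3 : Tendsto (uderiv v) (𝓝[>] 0) (𝓝 0) := by
        have := (h.uderiv_cont 0 self_mem_Ici).mono Ioi_subset_Ici_self
        rwa [ContinuousWithinAt, h.init_deriv] at this
      have h4 : Tendsto (fun r => |uderiv v r| ^ (p - 1)) (𝓝[>] 0) (𝓝 0) := by
        have h5 := h3.abs.rpow_const (p := p - 1) (Or.inr (by linarith [h.one_lt]))
        rwa [abs_zero, Real.zero_rpow (by linarith [h.one_lt])] at h5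
      exact h4.congr fun r => (abs_phiP h.one_lt _).symm
    have h6 : Tendsto (fun r : ℝ => r ^ (n - 2)) (𝓝[>] 0) (𝓝 (0 ^ (n - 2))) :=
      ((continuous_pow (n - 2)).tendsto 0).mono_left nhdsWithin_le_nhds
    simpa using h6.mul h2
  refine h1.congr' ?_
  filter_upwards [self_mem_nhdsWithin] with r hr
  have hr : r ≠ 0 := ne_of_gt hr
  rw [slope_def_field, h.flux_zero, flux, show n - 1 = (n - 2) + 1 by omega, pow_succ]
  field_simp
  ring

theorem flux_hasDerivWithinAt {r : ℝ} (hr : 0 ≤ r) :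
    HasDerivWithinAt (flux p n v) (-(weight n K r * f (v r))) (Ici 0) r := by
  rcases hr.eq_or_lt with rfl | hr
  · simpa [h.weight_zero] using h.flux_hasDerivWithinAt_zero
  · exact h.sol.2.2.2.2 r hr.le hr

theorem flux_contDiffOn : ContDiffOn ℝ 1 (flux p n v) (Ici 0) := h.sol.2.2.2.1

theorem weight_cont : ContinuousOn (weight n K) (Ici 0) := by
  intro r hr
  rcases (mem_Ici.1 hr).eq_or_lt with rfl | hr
  · have h1 : ContinuousWithinAt (fun r => weight n K r * f (v r)) (Ici 0) 0 := by
      have := (h.flux_contDiffOn.continuousOn_derivWithin (uniqueDiffOn_Ici 0) le_rfl).neg 0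
        self_mem_Ici
      refine this.congr (fun r hr => ?_) ?_
      · simp [(h.flux_hasDerivWithinAt hr).derivWithin (uniqueDiffOn_Ici 0 r hr)]
      · simp [(h.flux_hasDerivWithinAt le_rfl).derivWithin (uniqueDiffOn_Ici 0 0 self_mem_Ici)]
    have h2 : ContinuousWithinAt (fun r => f (v r)) (Ici 0) 0 := by
      refine ContinuousAt.comp_continuousWithinAt ?_ (h.cont 0 self_mem_Ici)
      rw [h.init]
      exact h.f_cont.continuousAt (Ici_mem_nhds h.lt_init)
    have hne : f (v 0) ≠ 0 := by rw [h.init]; exact (h.f_pos α h.lt_init).ne'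
    refine (h1.div h2 hne).congr_of_eventuallyEq ?_ ?_
    · filter_upwards [h2.eventually_ne hne] with r hr
      simp [hr]
    · simp [hne]
  · exact ((continuous_pow (n - 1)).continuousAt.mul
      (h.K_cont.continuousAt (Ioi_mem_nhds hr))).continuousWithinAt

theorem le_of_forall_Ico {R : ℝ} (hR : 0 < R) (hv : ∀ t ∈ Ico 0 R, u₀ < v t) :
    ∀ t ∈ Icc 0 R, u₀ ≤ v t := by
  have h1 : IsClosed (Icc 0 R ∩ v ⁻¹' Ici u₀) :=
    (h.cont.mono Icc_subset_Ici_self).preimage_isClosed_of_isClosed isClosed_Icc isClosed_Ici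
  have h2 : closure (Ico 0 R) ⊆ Icc 0 R ∩ v ⁻¹' Ici u₀ :=
    h1.closure_subset_iff.2 fun t ht => ⟨⟨ht.1, ht.2.le⟩, (hv t ht).le⟩
  rw [closure_Ico hR.ne] at h2
  exact fun t ht => (h2 ht).2

theorem comp_cont {g : ℝ → ℝ} (hg : ContinuousOn g (Ici u₀)) {R : ℝ}
    (hv : ∀ t ∈ Icc 0 R, u₀ ≤ v t) : ContinuousOn (fun t => g (v t)) (Icc 0 R) :=
  hg.comp (h.cont.mono Icc_subset_Ici_self) hv

theorem source_cont {R : ℝ} (hv : ∀ t ∈ Icc 0 R, u₀ ≤ v t) :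
    ContinuousOn (fun t => weight n K t * f (v t)) (Icc 0 R) :=
  (h.weight_cont.mono Icc_subset_Ici_self).mul (h.comp_cont h.f_cont hv)

theorem linInner_cont {R : ℝ} (hv : ∀ t ∈ Icc 0 R, u₀ ≤ v t) :
    ContinuousOn (linInner n K f u₀ v) (Icc 0 R) :=
  (h.weight_cont.mono Icc_subset_Ici_self).mul (h.comp_cont h.fder_cont hv)

theorem flux_eq_neg_mass {r : ℝ} (hr : 0 ≤ r) (hv : ∀ t ∈ Icc 0 r, u₀ ≤ v t) :
    flux p n v r = -mass n K f v r := by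
  have := intervalIntegral.integral_eq_sub_of_hasDerivAt_of_le (f := fun t => -flux p n v t)
    (f' := fun t => weight n K t * f (v t)) hr
    (h.flux_contDiffOn.continuousOn.neg.mono Icc_subset_Ici_self)
    (fun x hx => by
      have := ((h.flux_hasDerivWithinAt hx.1.le).hasDerivAt (Ici_mem_nhds hx.1)).neg
      rwa [neg_neg] at this)
    ((h.source_cont hv).intervalIntegrable_of_Icc hr)
  rw [mass, this, h.flux_zero]
  simp

theorem mass_pos {r : ℝ} (hr : 0 < r) (hv : ∀ t ∈ Ico 0 r, u₀ < v t) :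
    0 < mass n K f v r := by
  refine intervalIntegral.intervalIntegral_pos_of_pos_on
    ((h.source_cont (h.le_of_forall_Ico hr hv)).intervalIntegrable_of_Icc hr.le)
    (fun x hx => mul_pos (h.weight_pos hx.1) (h.f_pos _ (hv x ⟨hx.1.le, hx.2⟩))) hr

theorem uderiv_eq {r : ℝ} (hr : 0 < r) (hv : ∀ t ∈ Ico 0 r, u₀ < v t) :
    uderiv v r = -(mass n K f v r / r ^ (n - 1)) ^ (1 / (p - 1)) := by
  have hrn : 0 < r ^ (n - 1) := pow_pos hr _
  refine eq_of_phiP_eq_neg h.one_lt (div_pos (h.mass_pos hr hv) hrn) ?_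
  have := h.flux_eq_neg_mass hr.le (h.le_of_forall_Ico hr hv)
  rw [flux] at this
  field_simp
  linarith

theorem uderiv_neg {r : ℝ} (hr : 0 < r) (hv : ∀ t ∈ Ico 0 r, u₀ < v t) : uderiv v r < 0 := by
  rw [h.uderiv_eq hr hv, neg_lt_zero]
  exact Real.rpow_pos_of_pos (div_pos (h.mass_pos hr hv) (pow_pos hr _)) _

theorem mass_eq_mul_rpow {r : ℝ} (hr : 0 < r) (hv : ∀ t ∈ Ico 0 r, u₀ < v t) :
    mass n K f v r = r ^ (n - 1) * |uderiv v r| ^ (p - 2) * |uderiv v r| := by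
  have h1 := h.flux_eq_neg_mass hr.le (h.le_of_forall_Ico hr hv)
  rw [flux, phiP] at h1
  rw [abs_of_neg (h.uderiv_neg hr hv)] at h1 ⊢
  linarith

/-- The defining property of `linOuter`. -/
theorem mul_linOuter {r : ℝ} (hr : 0 < r) (hv : ∀ t ∈ Ico 0 r, u₀ < v t) :
    r ^ (n - 1) * |uderiv v r| ^ (p - 2) * linOuter p n K f v r = 1 / (p - 1) := by
  have h0 : |uderiv v r| ≠ 0 := abs_ne_zero.2 (h.uderiv_neg hr hv).ne
  have h1 := h.mass_pos hr hv
  have hp : p - 1 ≠ 0 := by linarith [h.one_lt]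
  rw [linOuter]
  have h2 := h.mass_eq_mul_rpow hr hv
  field_simp
  rw [h2]

theorem eq_init_add_integral {r : ℝ} (hr : 0 ≤ r) :
    v r = α + ∫ t in (0:ℝ)..r, uderiv v t := by
  rw [intervalIntegral.integral_eq_sub_of_hasDerivAt_of_le hr
    (h.cont.mono Icc_subset_Ici_self) (fun x hx => h.hasDerivAt hx.1)
    ((h.uderiv_cont.mono Icc_subset_Ici_self).intervalIntegrable_of_Icc hr), h.init]
  ring

theorem total_weight_pos {r : ℝ} (hr : 0 < r) : 0 < ∫ t in (0:ℝ)..r, weight n K t :=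
  intervalIntegral.intervalIntegral_pos_of_pos_on
    ((h.weight_cont.mono Icc_subset_Ici_self).intervalIntegrable_of_Icc hr.le)
    (fun _ hx => h.weight_pos hx.1) hr

theorem abs_integral_weight_mul_le {g : ℝ → ℝ} {c r : ℝ} (hr : 0 ≤ r)
    (hg : ∀ t ∈ Icc 0 r, |g t| ≤ c) :
    |∫ t in (0:ℝ)..r, weight n K t * g t| ≤ (∫ t in (0:ℝ)..r, weight n K t) * c := by
  rw [← intervalIntegral.integral_mul_const, ← Real.norm_eq_abs]
  refine intervalIntegral.norm_integral_le_of_norm_le hr (ae_of_all _ fun t ht => ?_) ?_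
  · rw [Real.norm_eq_abs, abs_mul, abs_of_nonneg (h.weight_nonneg ht.1.le)]
    exact mul_le_mul_of_nonneg_left (hg t ⟨ht.1.le, ht.2⟩) (h.weight_nonneg ht.1.le)
  · exact ((h.weight_cont.mono Icc_subset_Ici_self).intervalIntegrable_of_Icc hr).mul_const c

theorem mul_le_mass {c r : ℝ} (hr : 0 ≤ r) (hv : ∀ t ∈ Icc 0 r, u₀ ≤ v t)
    (hc : ∀ t ∈ Icc 0 r, c ≤ f (v t)) :
    (∫ t in (0:ℝ)..r, weight n K t) * c ≤ mass n K f v r := by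
  rw [← intervalIntegral.integral_mul_const]
  refine intervalIntegral.integral_mono_on hr
    (((h.weight_cont.mono Icc_subset_Ici_self).intervalIntegrable_of_Icc hr).mul_const c)
    ((h.source_cont hv).intervalIntegrable_of_Icc hr) fun t ht =>
    mul_le_mul_of_nonneg_left (hc t ht) (h.weight_nonneg ht.1)

theorem mass_cont {R : ℝ} (hR : 0 ≤ R) (hv : ∀ t ∈ Icc 0 R, u₀ ≤ v t) :
    ContinuousOn (mass n K f v) (Icc 0 R) := by
  rw [← uIcc_of_le hR]
  apply intervalIntegral.continuousOn_primitive_interval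
  rw [uIcc_of_le hR]
  exact (h.source_cont hv).integrableOn_Icc

theorem exists_pos_le_source {R : ℝ} (hR : 0 ≤ R) (hv : ∀ t ∈ Icc 0 R, u₀ < v t) :
    ∃ c > 0, ∀ t ∈ Icc 0 R, c ≤ f (v t) := by
  obtain ⟨t₀, ht₀, hmin⟩ := isCompact_Icc.exists_isMinOn (nonempty_Icc.2 hR)
    (h.comp_cont h.f_cont fun t ht => (hv t ht).le)
  exact ⟨f (v t₀), h.f_pos _ (hv t₀ ht₀), fun t ht => hmin ht⟩

theorem linOuter_cont {R : ℝ} (hR : 0 < R) (hv : ∀ t ∈ Ico 0 R, u₀ < v t) :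
    ContinuousOn (linOuter p n K f v) (Ioc 0 R) := by
  have hsub : Ioc 0 R ⊆ Ici (0:ℝ) := fun t ht => ht.1.le
  refine ContinuousOn.div (continuousOn_const.mul (h.uderiv_cont.mono hsub).abs)
    ((h.mass_cont hR.le (h.le_of_forall_Ico hR hv)).mono Ioc_subset_Icc_self) fun t ht => ?_
  exact (h.mass_pos ht.1 fun s hs => hv s ⟨hs.1, hs.2.trans_le ht.2⟩).ne'

theorem isVolterraKernel {R : ℝ} (hR : 0 < R) (hv : ∀ t ∈ Ico 0 R, u₀ < v t) :
    ∃ C, 0 ≤ C ∧ IsVolterraKernel R C (linOuter p n K f v) (linInner n K f u₀ v) := by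
  have hv' := h.le_of_forall_Ico hR hv
  have hR2 : 0 < R / 2 := half_pos hR
  have hRR : R / 2 < R := half_lt_self hR
  obtain ⟨c, hc, hcf⟩ := h.exists_pos_le_source hR2.le
    fun t ht => hv t ⟨ht.1, ht.2.trans_lt hRR⟩
  obtain ⟨D, hD⟩ := isCompact_Icc.exists_bound_of_continuousOn
    (h.uderiv_cont.mono (Icc_subset_Ici_self : Icc 0 R ⊆ Ici 0))
  obtain ⟨L, hL⟩ := isCompact_Icc.exists_bound_of_continuousOn (h.comp_cont h.fder_cont hv')
  have hinner := h.linInner_cont hv'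
  have habs : ContinuousOn (fun s => |linOuter p n K f v s| *
      ∫ t in (0:ℝ)..s, |linInner n K f u₀ v t|) (Icc (R / 2) R) := by
    refine ContinuousOn.mul ((h.linOuter_cont hR hv).mono
      fun t ht => ⟨hR2.trans_le ht.1, ht.2⟩).abs ?_
    refine ContinuousOn.mono (s := Icc 0 R) ?_ (Icc_subset_Icc_left hR2.le)
    have : IntegrableOn (fun t => |linInner n K f u₀ v t|) (uIcc 0 R) := by
      rw [uIcc_of_le hR.le]; exact hinner.abs.integrableOn_Icc
    simpa [uIcc_of_le hR.le] using intervalIntegral.continuousOn_primitive_interval this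
  obtain ⟨E, hE⟩ := isCompact_Icc.exists_bound_of_continuousOn habs
  have hq : 0 < 1 / (p - 1) := one_div_pos.2 (by linarith [h.one_lt])
  have hD0 : 0 ≤ D := (norm_nonneg _).trans (hD 0 ⟨le_rfl, hR.le⟩)
  have hL0 : 0 ≤ L := (norm_nonneg _).trans (hL 0 ⟨le_rfl, hR.le⟩)
  have hCnn : 0 ≤ 1 / (p - 1) * D * L / c := by positivity
  refine ⟨max (1 / (p - 1) * D * L / c) E, le_max_of_le_left hCnn, hinner,
    h.linOuter_cont hR hv, fun s hs => ?_⟩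
  rcases le_total (R / 2) s with hs2 | hs2
  · exact ((le_abs_self _).trans (hE s ⟨hs2, hs.2⟩)).trans (le_max_right _ _)
  · refine le_trans ?_ (le_max_left _ _)
    have hsI : ∀ t ∈ Icc 0 s, t ∈ Icc 0 R := fun t ht => ⟨ht.1, ht.2.trans hs.2⟩
    have hA := h.total_weight_pos hs.1
    have hm := h.mul_le_mass hs.1.le (fun t ht => hv' t (hsI t ht))
      fun t ht => hcf t ⟨ht.1, ht.2.trans hs2⟩
    have hmpos : 0 < mass n K f v s := (mul_pos hA hc).trans_le hm
    have h1 : ∫ t in (0:ℝ)..s, |linInner n K f u₀ v t| ≤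
        (∫ t in (0:ℝ)..s, weight n K t) * L := by
      have h2 := h.abs_integral_weight_mul_le (g := fun t => |fder f u₀ (v t)|) (c := L) hs.1.le
        fun t ht => by simpa using hL t (hsI t ht)
      refine le_trans (le_of_eq ?_) ((le_abs_self _).trans h2)
      refine intervalIntegral.integral_congr fun t ht => ?_
      rw [uIcc_of_le hs.1.le] at ht
      simp only [linInner, abs_mul, abs_of_nonneg (h.weight_nonneg ht.1)]
    have h3 : |linOuter p n K f v s| ≤ 1 / (p - 1) * D / mass n K f v s := by
      rw [linOuter, abs_div, abs_mul, abs_abs, abs_of_pos hq, abs_of_pos hmpos]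
      gcongr
      exact hD s ⟨hs.1.le, hs.2⟩
    calc _ ≤ 1 / (p - 1) * D / mass n K f v s * ((∫ t in (0:ℝ)..s, weight n K t) * L) := by
          gcongr
          exact intervalIntegral.integral_nonneg hs.1.le fun _ _ => abs_nonneg _
      _ = 1 / (p - 1) * D * L * ((∫ t in (0:ℝ)..s, weight n K t) / mass n K f v s) := by ring
      _ ≤ 1 / (p - 1) * D * L * (1 / c) := by
          refine mul_le_mul_of_nonneg_left ?_ (by positivity)
          rw [div_le_div_iff₀ hmpos hc]
          linarith
      _ = _ := by ring

end

end RadialIVP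

/-- A family of solutions `u(α) = u(·,α)`, jointly continuous in `(α,r)`. -/
structure RadialFamily (p : ℝ) (n : ℕ) (K f : ℝ → ℝ) (u₀ : ℝ) (u : ℝ → ℝ → ℝ) : Prop where
  ivp : ∀ α, u₀ < α → RadialIVP p n K f u₀ α (u α)
  cont : ContinuousOn (fun q : ℝ × ℝ => u q.1 q.2) (Ioi u₀ ×ˢ Ici 0)
  cont_uderiv : ContinuousOn (fun q : ℝ × ℝ => uderiv (u q.1) q.2) (Ioi u₀ ×ˢ Ici 0)

namespace RadialFamily

variable {p : ℝ} {n : ℕ} {K f : ℝ → ℝ} {u₀ : ℝ} {u : ℝ → ℝ → ℝ}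
  (H : RadialFamily p n K f u₀ u) {α R : ℝ}
include H

theorem continuousAt_max (hα : u₀ < α) (t : ℝ) :
    ContinuousAt (fun q : ℝ × ℝ => u q.1 (max q.2 0)) (α, t) := by
  have h1 : ContinuousOn (fun q : ℝ × ℝ => u q.1 (max q.2 0)) (Ioi u₀ ×ˢ univ) :=
    H.cont.comp (f := fun q : ℝ × ℝ => (q.1, max q.2 0))
      (Continuous.continuousOn (by fun_prop)) fun q hq =>
        ⟨hq.1, show (0:ℝ) ≤ max q.2 0 from le_max_right _ _⟩
  exact h1.continuousAt ((isOpen_Ioi.prod isOpen_univ).mem_nhds ⟨hα, mem_univ _⟩)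

theorem eventually_close (hα : u₀ < α) (R : ℝ) {δ : ℝ} (hδ : 0 < δ) :
    ∀ᶠ β in 𝓝 α, ∀ t ∈ Icc 0 R, |u β t - u α t| < δ := by
  have key : ∀ᶠ β in 𝓝 α, ∀ t ∈ Icc 0 R, |u β (max t 0) - u α (max t 0)| < δ := by
    refine isCompact_Icc.eventually_forall_of_forall_eventually fun t _ => ?_
    have h1 := H.continuousAt_max hα t
    have h2 : ContinuousAt (fun q : ℝ × ℝ => u α (max q.2 0)) (α, t) :=
      ContinuousAt.comp (g := fun q : ℝ × ℝ => u q.1 (max q.2 0))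
        (f := fun q : ℝ × ℝ => (α, q.2)) (x := (α, t)) h1 (by fun_prop)
    have h3 := (h1.sub h2).abs
    exact h3.tendsto.eventually (gt_mem_nhds (by simpa using hδ))
  filter_upwards [key] with β hβ t ht
  simpa [max_eq_left ht.1] using hβ t ht

theorem eventually_gt (hα : u₀ < α) (hv : ∀ t ∈ Icc 0 R, u₀ < u α t) :
    ∀ᶠ β in 𝓝 α, u₀ < β ∧ ∀ t ∈ Icc 0 R, u₀ < u β t := by
  have key : ∀ᶠ β in 𝓝 α, ∀ t ∈ Icc 0 R, u₀ < u β (max t 0) := by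
    refine isCompact_Icc.eventually_forall_of_forall_eventually fun t ht => ?_
    refine (H.continuousAt_max hα t).tendsto.eventually (lt_mem_nhds ?_)
    simpa [max_eq_left ht.1] using hv t ht
  filter_upwards [key, lt_mem_nhds hα] with β hβ hβ0
  exact ⟨hβ0, fun t ht => by simpa [max_eq_left ht.1] using hβ t ht⟩

theorem eventually_source_strict (hα : u₀ < α) (hv : ∀ t ∈ Icc 0 R, u₀ < u α t) {ε : ℝ}
    (hε : 0 < ε) :
    ∀ᶠ q : ℝ × ℝ in 𝓝 (α, α), ∀ t ∈ Icc 0 R,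
      |f (u q.1 t) - f (u q.2 t) - fder f u₀ (u α t) * (u q.1 t - u q.2 t)| ≤
        ε * |u q.1 t - u q.2 t| := by
  have h := H.ivp α hα
  obtain ⟨δ, hδ, hstrict⟩ :=
    (isCompact_Icc.image_of_continuousOn (h.cont.mono Icc_subset_Ici_self :
      ContinuousOn (u α) (Icc 0 R))).exists_uniform_strict_deriv isOpen_Ioi
      (image_subset_iff.2 hv) (fun x hx => hasStrictDerivAt_of_contDiffOn_Ici h.f_contDiff hx)
      (h.fder_cont.mono Ioi_subset_Ici_self) hε
  have hc := H.eventually_close hα R hδ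
  filter_upwards [hc.prod_nhds hc] with q hq t ht
  exact hstrict _ (mem_image_of_mem _ ht) _ _ (hq.1 t ht) (hq.2 t ht)

/-- Linearization of the mass, uniformly on `[0,R]`. -/
theorem eventually_mass_linearization (hα : u₀ < α)
    (hv : ∀ t ∈ Icc 0 R, u₀ < u α t) {ε : ℝ} (hε : 0 < ε) :
    ∀ᶠ q : ℝ × ℝ in 𝓝 (α, α), ∀ M, (∀ t ∈ Icc 0 R, |u q.1 t - u q.2 t| ≤ M) →
      ∀ s ∈ Icc 0 R,
        |mass n K f (u q.1) s - mass n K f (u q.2) s -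
          ∫ t in (0:ℝ)..s, linInner n K f u₀ (u α) t * (u q.1 t - u q.2 t)| ≤
        (∫ t in (0:ℝ)..s, weight n K t) * (ε * M) := by
  have h := H.ivp α hα
  have hgt := H.eventually_gt hα hv
  filter_upwards [hgt.prod_nhds hgt, H.eventually_source_strict hα hv hε] with q hq hs M hM s hsR
  have hI : ∀ t ∈ Icc 0 s, t ∈ Icc 0 R := fun t ht => ⟨ht.1, ht.2.trans hsR.2⟩
  have h1 := H.ivp q.1 hq.1.1
  have h2 := H.ivp q.2 hq.2.1
  have i1 := (h1.source_cont (R := s) fun t ht =>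
    (hq.1.2 t (hI t ht)).le).intervalIntegrable_of_Icc (μ := volume) hsR.1
  have i2 := (h2.source_cont (R := s) fun t ht =>
    (hq.2.2 t (hI t ht)).le).intervalIntegrable_of_Icc (μ := volume) hsR.1
  have i3 : IntervalIntegrable (fun t => linInner n K f u₀ (u α) t * (u q.1 t - u q.2 t))
      volume 0 s := ((h.linInner_cont (R := s) fun t ht => (hv t (hI t ht)).le).mul
    ((h1.cont.sub h2.cont).mono Icc_subset_Ici_self)).intervalIntegrable_of_Icc
    (μ := volume) hsR.1
  have key := h.abs_integral_weight_mul_le (r := s) (c := ε * M)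
    (g := fun t => f (u q.1 t) - f (u q.2 t) - fder f u₀ (u α t) * (u q.1 t - u q.2 t)) hsR.1
    fun t ht => (hs t (hI t ht)).trans (mul_le_mul_of_nonneg_left (hM t (hI t ht)) hε.le)
  refine le_trans (le_of_eq ?_) key
  congr 1
  rw [mass, mass, ← intervalIntegral.integral_sub i1 i2,
    ← intervalIntegral.integral_sub (i1.sub i2) i3]
  congr 1
  ext t
  simp only [linInner]
  ring

theorem exists_abs_inner_le (hα : u₀ < α) (hR : 0 ≤ R)
    (hv : ∀ t ∈ Icc 0 R, u₀ < u α t) :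
    ∃ L, 0 ≤ L ∧ ∀ η : ℝ → ℝ, ∀ M, (∀ t ∈ Icc 0 R, |η t| ≤ M) → ∀ s ∈ Icc 0 R,
      |∫ t in (0:ℝ)..s, linInner n K f u₀ (u α) t * η t| ≤
        (∫ t in (0:ℝ)..s, weight n K t) * (L * M) := by
  have h := H.ivp α hα
  obtain ⟨L, hL⟩ := isCompact_Icc.exists_bound_of_continuousOn
    (h.comp_cont h.fder_cont fun t ht => (hv t ht).le)
  have hL0 : 0 ≤ L := (norm_nonneg _).trans (hL 0 ⟨le_rfl, hR⟩)
  refine ⟨L, hL0, fun η M hM s hs => ?_⟩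
  have key := h.abs_integral_weight_mul_le (g := fun t => fder f u₀ (u α t) * η t) (c := L * M)
    hs.1 fun t ht => by
      have ht' : t ∈ Icc 0 R := ⟨ht.1, ht.2.trans hs.2⟩
      rw [abs_mul]
      exact mul_le_mul (hL t ht') (hM t ht') (abs_nonneg _) hL0
  simpa only [linInner, mul_assoc] using key

/-- The mass depends continuously on the initial value, relative to the total weight. -/
theorem eventually_mass_close (hα : u₀ < α) (hR : 0 ≤ R)
    (hv : ∀ t ∈ Icc 0 R, u₀ < u α t) {δ : ℝ} (hδ : 0 < δ) :
    ∀ᶠ β in 𝓝 α, ∀ s ∈ Icc 0 R,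
      |mass n K f (u β) s - mass n K f (u α) s| ≤ (∫ t in (0:ℝ)..s, weight n K t) * δ := by
  obtain ⟨L, hL0, hL⟩ := H.exists_abs_inner_le hα hR hv
  have hη : 0 < δ / (1 + L) := by positivity
  have h1 : Tendsto (fun β : ℝ => (β, α)) (𝓝 α) (𝓝 (α, α)) :=
    (by fun_prop : Continuous fun β : ℝ => (β, α)).tendsto α
  filter_upwards [h1.eventually (H.eventually_mass_linearization hα hv one_pos),
    H.eventually_close hα R hη] with β hβ1 hβ2 s hs
  have h2 := hβ1 _ (fun t ht => (hβ2 t ht).le) s hs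
  have h3 := hL _ _ (fun t ht => (hβ2 t ht).le) s hs
  set A := ∫ t in (0:ℝ)..s, weight n K t
  set J := ∫ t in (0:ℝ)..s, linInner n K f u₀ (u α) t * (u β t - u α t)
  have h4 : A * (1 * (δ / (1 + L))) + A * (L * (δ / (1 + L))) = A * δ := by field_simp
  rw [← h4]
  have h5 := abs_add_le (mass n K f (u β) s - mass n K f (u α) s - J) J
  rw [sub_add_cancel] at h5
  exact h5.trans (add_le_add h2 h3)

/-- Linearization of `u'`, uniformly on `(0,R]`. -/
theorem eventually_uderiv_linearization (hα : u₀ < α) (hR : 0 < R)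
    (hv : ∀ t ∈ Icc 0 R, u₀ < u α t) {ε : ℝ} (hε : 0 < ε) :
    ∀ᶠ q : ℝ × ℝ in 𝓝 (α, α), ∀ M, (∀ t ∈ Icc 0 R, |u q.1 t - u q.2 t| ≤ M) →
      ∀ s ∈ Ioc 0 R,
        |uderiv (u q.1) s - uderiv (u q.2) s + linOuter p n K f (u α) s *
          ∫ t in (0:ℝ)..s, linInner n K f u₀ (u α) t * (u q.1 t - u q.2 t)| ≤ ε * M := by
  have h := H.ivp α hα
  obtain ⟨L, hL0, hL⟩ := H.exists_abs_inner_le hα hR.le hv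
  have hv' : ∀ t ∈ Icc 0 R, u₀ ≤ u α t := fun t ht => (hv t ht).le
  obtain ⟨c, hc, hcf⟩ := h.exists_pos_le_source hR.le hv
  obtain ⟨d, hd⟩ := isCompact_Icc.exists_bound_of_continuousOn (h.comp_cont h.f_cont hv')
  obtain ⟨D, hD⟩ := isCompact_Icc.exists_bound_of_continuousOn
    (h.uderiv_cont.mono (Icc_subset_Ici_self : Icc 0 R ⊆ Ici 0))
  have hD0 : 0 ≤ D := (norm_nonneg _).trans (hD 0 ⟨le_rfl, hR.le⟩)
  set m := 1 / (p - 1) with hm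
  have hm0 : 0 < m := one_div_pos.2 (by linarith [h.one_lt])
  have hF'c : ContinuousOn (fun x : ℝ => m * x ^ (m - 1)) (Ioi 0) :=
    continuousOn_const.mul (continuousOn_id.rpow_const fun x hx => Or.inl (ne_of_gt hx))
  have hSU : Icc c d ⊆ Ioi (0:ℝ) := fun x hx => hc.trans_le hx.1
  obtain ⟨E, hE⟩ := (isCompact_Icc (a := c) (b := d)).exists_bound_of_continuousOn
    (hF'c.mono hSU)
  have hcd : c ≤ d := (hcf 0 ⟨le_rfl, hR.le⟩).trans
    ((le_abs_self _).trans (hd 0 ⟨le_rfl, hR.le⟩))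
  have hE0 : 0 ≤ E := (norm_nonneg _).trans (hE c ⟨le_rfl, hcd⟩)
  set G := D / c ^ m with hG
  have hcm : 0 < c ^ m := Real.rpow_pos_of_pos hc _
  have hG0 : 0 ≤ G := by positivity
  set e := min 1 (ε / (G * (L + 1 + E) + 1)) with he
  have he0 : 0 < e := by positivity
  have he1 : e ≤ 1 := min_le_left _ _
  have heε : G * (e * (L + 1 + E)) ≤ ε := by
    have h1 : e ≤ ε / (G * (L + 1 + E) + 1) := min_le_right _ _
    have hpos : 0 < G * (L + 1 + E) + 1 := by positivity
    rw [le_div_iff₀ hpos] at h1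
    linarith only [h1, he0]
  obtain ⟨δ, hδ, hstrict⟩ := (isCompact_Icc (a := c) (b := d)).exists_uniform_strict_deriv
    isOpen_Ioi hSU (F := fun x => x ^ m) (F' := fun x => m * x ^ (m - 1))
    (fun x hx => Real.hasStrictDerivAt_rpow_const_of_ne (ne_of_gt hx) m) hF'c he0
  have hgt := H.eventually_gt hα hv
  have hclose := H.eventually_mass_close hα hR.le hv (half_pos hδ)
  filter_upwards [hgt.prod_nhds hgt, hclose.prod_nhds hclose,
    H.eventually_mass_linearization hα hv he0] with q hq hqm hql M hM s hs
  have hs' : s ∈ Icc 0 R := ⟨hs.1.le, hs.2⟩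
  have hI : ∀ t ∈ Icc 0 s, t ∈ Icc 0 R := fun t ht => ⟨ht.1, ht.2.trans hs.2⟩
  have hJ : ∀ t ∈ Ico 0 s, t ∈ Icc 0 R := fun t ht => ⟨ht.1, ht.2.le.trans hs.2⟩
  have hM0 : 0 ≤ M := (abs_nonneg _).trans (hM 0 ⟨le_rfl, hR.le⟩)
  have hA := h.total_weight_pos hs.1
  have hlow := h.mul_le_mass hs.1.le (fun t ht => hv' t (hI t ht)) fun t ht => hcf t (hI t ht)
  have hup : mass n K f (u α) s ≤ (∫ t in (0:ℝ)..s, weight n K t) * d :=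
    (le_abs_self _).trans (h.abs_integral_weight_mul_le hs.1.le fun t ht => hd t (hI t ht))
  have hrep : ∀ β, u₀ < β → (∀ t ∈ Icc 0 R, u₀ < u β t) → uderiv (u β) s =
      -(((∫ t in (0:ℝ)..s, weight n K t) / s ^ (n - 1)) ^ m *
        (mass n K f (u β) s / ∫ t in (0:ℝ)..s, weight n K t) ^ m) := by
    intro β hβ hβv
    have hβs : ∀ t ∈ Ico 0 s, u₀ < u β t := fun t ht => hβv t (hJ t ht)
    have hmp := (H.ivp β hβ).mass_pos hs.1 hβs
    rw [(H.ivp β hβ).uderiv_eq hs.1 hβs, ← Real.mul_rpow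
      (div_pos hA (pow_pos hs.1 _)).le (div_pos hmp hA).le]
    congr 2
    have := pow_pos hs.1 (n - 1)
    field_simp
  have hlin := hql M hM s hs'
  have hLM := hL _ M hM s hs'
  have hc1 := hqm.1 s hs'
  have hc2 := hqm.2 s hs'
  have r1 := hrep q.1 hq.1.1 hq.1.2
  have r2 := hrep q.2 hq.2.1 hq.2.2
  have r0 := hrep α hα hv
  have hmα := h.mass_pos hs.1 fun t ht => hv t (hJ t ht)
  have hDs := hD s hs'
  have hneg := h.uderiv_neg hs.1 fun t ht => hv t (hJ t ht)
  set A := ∫ t in (0:ℝ)..s, weight n K t with hAdef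
  set J := ∫ t in (0:ℝ)..s, linInner n K f u₀ (u α) t * (u q.1 t - u q.2 t) with hJdef
  set g := (A / s ^ (n - 1)) ^ m with hgdef
  have hg0 : 0 < g := Real.rpow_pos_of_pos (div_pos hA (pow_pos hs.1 _)) _
  set X := mass n K f (u q.1) s / A with hX
  set Y := mass n K f (u q.2) s / A with hY
  set Z := mass n K f (u α) s / A with hZ
  have hZc : c ≤ Z := by rw [hZ, le_div_iff₀ hA]; linarith only [hlow]
  have hZd : Z ≤ d := by rw [hZ, div_le_iff₀ hA]; linarith only [hup]
  have hZ0 : 0 < Z := hc.trans_le hZc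
  have hXZ : |X - Z| < δ := by
    rw [hX, hZ, ← sub_div, abs_div, abs_of_pos hA, div_lt_iff₀ hA]
    linarith only [hc1, mul_pos hA hδ]
  have hYZ : |Y - Z| < δ := by
    rw [hY, hZ, ← sub_div, abs_div, abs_of_pos hA, div_lt_iff₀ hA]
    linarith only [hc2, mul_pos hA hδ]
  have hXYJ : |X - Y - J / A| ≤ e * M := by
    rw [hX, hY, ← sub_div, ← sub_div, abs_div, abs_of_pos hA, div_le_iff₀ hA]
    linarith only [hlin]
  have hJA : |J / A| ≤ L * M := by
    rw [abs_div, abs_of_pos hA, div_le_iff₀ hA]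
    linarith only [hLM]
  have hXY : |X - Y| ≤ (L + 1) * M := by
    have h1 := abs_add_le (X - Y - J / A) (J / A)
    rw [sub_add_cancel] at h1
    linarith only [h1, hXYJ, hJA, mul_le_mul_of_nonneg_right he1 hM0]
  have hgG : g ≤ G := by
    rw [hG, le_div_iff₀ hcm]
    have h1 : |uderiv (u α) s| = g * Z ^ m := by
      rw [abs_of_neg hneg, r0, neg_neg]
    have h2 : c ^ m ≤ Z ^ m := Real.rpow_le_rpow hc.le hZc hm0.le
    calc g * c ^ m ≤ g * Z ^ m := mul_le_mul_of_nonneg_left h2 hg0.le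
      _ ≤ D := by rw [← h1]; exact hDs
  have hst := hstrict Z ⟨hZc, hZd⟩ X Y hXZ hYZ
  have hFE : |m * Z ^ (m - 1)| ≤ E := hE Z ⟨hZc, hZd⟩
  have hB : linOuter p n K f (u α) s * J = g * (m * Z ^ (m - 1) * (J / A)) := by
    rw [linOuter, abs_of_neg hneg, r0, neg_neg, ← hm, Real.rpow_sub_one hZ0.ne']
    have : mass n K f (u α) s = Z * A := by rw [hZ]; field_simp
    rw [this]
    field_simp
  rw [r1, r2, hB]
  set FZ := m * Z ^ (m - 1)
  have hfin : |X ^ m - Y ^ m - FZ * (J / A)| ≤ e * (L + 1 + E) * M := by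
    have h1 : X ^ m - Y ^ m - FZ * (J / A) =
        (X ^ m - Y ^ m - FZ * (X - Y)) + FZ * (X - Y - J / A) := by ring
    rw [h1]
    refine (abs_add_le _ _).trans ?_
    rw [abs_mul FZ]
    have h2 : e * |X - Y| ≤ e * ((L + 1) * M) := mul_le_mul_of_nonneg_left hXY he0.le
    have h3 : |FZ| * |X - Y - J / A| ≤ E * (e * M) :=
      mul_le_mul hFE hXYJ (abs_nonneg _) hE0
    linarith only [hst, h2, h3]
  have h1 : -(g * X ^ m) - -(g * Y ^ m) + g * (FZ * (J / A)) =
      -(g * (X ^ m - Y ^ m - FZ * (J / A))) := by ring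
  rw [h1, abs_neg, abs_mul, abs_of_pos hg0]
  calc g * |X ^ m - Y ^ m - FZ * (J / A)| ≤ G * (e * (L + 1 + E) * M) :=
        mul_le_mul hgG hfin (abs_nonneg _) hG0
    _ = G * (e * (L + 1 + E)) * M := by ring
    _ ≤ ε * M := mul_le_mul_of_nonneg_right heε hM0

/-- Differences of solutions solve the linearized integral equation approximately. -/
theorem eventually_linearization (hα : u₀ < α) (hR : 0 < R)
    (hv : ∀ t ∈ Icc 0 R, u₀ < u α t) {ε : ℝ} (hε : 0 < ε) :
    ∀ᶠ q : ℝ × ℝ in 𝓝 (α, α), ∀ M, (∀ t ∈ Icc 0 R, |u q.1 t - u q.2 t| ≤ M) →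
      ∀ r ∈ Icc 0 R,
        |(u q.1 r - u q.2 r) + volterra (linOuter p n K f (u α)) (linInner n K f u₀ (u α))
          (fun t => u q.1 t - u q.2 t) r - (q.1 - q.2)| ≤ ε * M := by
  have h := H.ivp α hα
  obtain ⟨C, hC, hk⟩ := h.isVolterraKernel hR fun t ht => hv t ⟨ht.1, ht.2.le⟩
  have hgt := H.eventually_gt hα hv
  filter_upwards [hgt.prod_nhds hgt,
    H.eventually_uderiv_linearization hα hR hv (div_pos hε hR)] with q hq hql M hM r hr
  have h1 := H.ivp q.1 hq.1.1
  have h2 := H.ivp q.2 hq.2.1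
  have hM0 : 0 ≤ M := (abs_nonneg _).trans (hM 0 ⟨le_rfl, hR.le⟩)
  have i1 := (h1.uderiv_cont.mono Icc_subset_Ici_self).intervalIntegrable_of_Icc
    (μ := volume) hr.1
  have i2 := (h2.uderiv_cont.mono Icc_subset_Ici_self).intervalIntegrable_of_Icc
    (μ := volume) hr.1
  have i3 : IntervalIntegrable (fun s => linOuter p n K f (u α) s *
      ∫ t in (0:ℝ)..s, linInner n K f u₀ (u α) t * (u q.1 t - u q.2 t)) volume 0 r :=
    hk.intervalIntegrable_integrand
    ((h1.cont.sub h2.cont).mono Icc_subset_Ici_self) hr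
  have key : (u q.1 r - u q.2 r) + volterra (linOuter p n K f (u α)) (linInner n K f u₀ (u α))
      (fun t => u q.1 t - u q.2 t) r - (q.1 - q.2) =
      ∫ s in (0:ℝ)..r, (uderiv (u q.1) s - uderiv (u q.2) s + linOuter p n K f (u α) s *
          ∫ t in (0:ℝ)..s, linInner n K f u₀ (u α) t * (u q.1 t - u q.2 t)) := by
    rw [intervalIntegral.integral_add (i1.sub i2) i3, intervalIntegral.integral_sub i1 i2,
      h1.eq_init_add_integral hr.1, h2.eq_init_add_integral hr.1, volterra]
    ring
  rw [key]
  have := intervalIntegral.norm_integral_le_of_norm_le_const (a := 0) (b := r)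
    (C := ε / R * M) (f := fun s => uderiv (u q.1) s - uderiv (u q.2) s +
      linOuter p n K f (u α) s *
        ∫ t in (0:ℝ)..s, linInner n K f u₀ (u α) t * (u q.1 t - u q.2 t)) fun s hs => by
      rw [uIoc_of_le hr.1] at hs
      exact hql M hM s ⟨hs.1, hs.2.trans hr.2⟩
  refine this.trans ?_
  rw [sub_zero, abs_of_nonneg hr.1]
  calc ε / R * M * r ≤ ε / R * M * R := mul_le_mul_of_nonneg_left hr.2 (by positivity)
    _ = ε * M := by field_simp

theorem exists_eventually_lipschitz (hα : u₀ < α) (hR : 0 < R)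
    (hv : ∀ t ∈ Icc 0 R, u₀ < u α t) :
    ∃ M > 0, ∀ᶠ q : ℝ × ℝ in 𝓝 (α, α), ∀ r ∈ Icc 0 R,
      |u q.1 r - u q.2 r| ≤ M * |q.1 - q.2| := by
  have h := H.ivp α hα
  obtain ⟨C, hC, hk⟩ := h.isVolterraKernel hR fun t ht => hv t ⟨ht.1, ht.2.le⟩
  set E := Real.exp ((2 * C + 1) * R) with hE
  have hE0 : 0 < E := Real.exp_pos _
  have hgt := H.eventually_gt hα hv
  refine ⟨4 * E, by positivity, ?_⟩
  filter_upwards [hgt.prod_nhds hgt, H.eventually_linearization hα hR hv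
    (show 0 < 1 / (4 * E) by positivity)] with q hq hql r hr
  have hη : ContinuousOn (fun t => u q.1 t - u q.2 t) (Icc 0 R) :=
    ((H.ivp q.1 hq.1.1).cont.sub (H.ivp q.2 hq.2.1).cont).mono Icc_subset_Ici_self
  obtain ⟨t₀, ht₀, hmax⟩ := isCompact_Icc.exists_isMaxOn (nonempty_Icc.2 hR.le) hη.abs
  have h1 := hk.abs_le_of_abs_add_volterra_le hC hη
    (ε := |q.1 - q.2| + 1 / (4 * E) * |u q.1 t₀ - u q.2 t₀|) (fun r hr => by
      have := hql _ (fun t ht => hmax ht) r hr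
      have h2 := abs_add_le ((u q.1 r - u q.2 r) + volterra (linOuter p n K f (u α))
        (linInner n K f u₀ (u α)) (fun t => u q.1 t - u q.2 t) r - (q.1 - q.2)) (q.1 - q.2)
      rw [sub_add_cancel] at h2
      exact h2.trans (by linarith)) t₀ ht₀
  have h3 : |u q.1 r - u q.2 r| ≤ |u q.1 t₀ - u q.2 t₀| := hmax hr
  refine h3.trans ?_
  rw [← hE] at h1
  have h4 : 2 * (|q.1 - q.2| + 1 / (4 * E) * |u q.1 t₀ - u q.2 t₀|) * E =
      2 * E * |q.1 - q.2| + |u q.1 t₀ - u q.2 t₀| / 2 := by field_simp; ring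
  rw [h4] at h1
  linarith

/-- Solutions are strictly differentiable in the initial value, uniformly on `[0,R]`. -/
theorem eventually_strict_deriv (hα : u₀ < α) (hR : 0 < R)
    (hv : ∀ t ∈ Icc 0 R, u₀ < u α t) {Φ : ℝ → ℝ} (hΦ : ContinuousOn Φ (Icc 0 R))
    (hΦe : ∀ r ∈ Icc 0 R, Φ r =
      1 - volterra (linOuter p n K f (u α)) (linInner n K f u₀ (u α)) Φ r)
    {ε : ℝ} (hε : 0 < ε) :
    ∀ᶠ q : ℝ × ℝ in 𝓝 (α, α), ∀ r ∈ Icc 0 R,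
      |u q.1 r - u q.2 r - Φ r * (q.1 - q.2)| ≤ ε * |q.1 - q.2| := by
  have h := H.ivp α hα
  obtain ⟨C, hC, hk⟩ := h.isVolterraKernel hR fun t ht => hv t ⟨ht.1, ht.2.le⟩
  obtain ⟨M, hM, hlip⟩ := H.exists_eventually_lipschitz hα hR hv
  set E := Real.exp ((2 * C + 1) * R) with hE
  have hE0 : 0 < E := Real.exp_pos _
  have hgt := H.eventually_gt hα hv
  filter_upwards [hgt.prod_nhds hgt, hlip, H.eventually_linearization hα hR hv
    (show 0 < ε / (2 * E * M) by positivity)] with q hq hqlip hql r hr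
  have hη : ContinuousOn (fun t => u q.1 t - u q.2 t) (Icc 0 R) :=
    ((H.ivp q.1 hq.1.1).cont.sub (H.ivp q.2 hq.2.1).cont).mono Icc_subset_Ici_self
  have h1 := hk.abs_le_of_abs_add_volterra_le hC (hη.sub (hΦ.const_mul (q.1 - q.2)))
    (ε := ε / (2 * E * M) * (M * |q.1 - q.2|)) (fun r hr => by
      have h2 := hql _ hqlip r hr
      refine le_trans (le_of_eq ?_) h2
      have h3 := hk.volterra_lincomb hη hΦ (q.1 - q.2) hr
      simp only [Pi.sub_def] at h3 ⊢
      rw [h3]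
      congr 1
      linear_combination (-(q.1 - q.2)) * hΦe r hr) r hr
  rw [← hE] at h1
  have h4 : 2 * (ε / (2 * E * M) * (M * |q.1 - q.2|)) * E = ε * |q.1 - q.2| := by
    field_simp
  rw [h4] at h1
  rwa [mul_comm (Φ r)]

/-- The mass is strictly differentiable in the initial value, uniformly on `[0,R]`. -/
theorem eventually_strict_deriv_mass (hα : u₀ < α) (hR : 0 < R)
    (hv : ∀ t ∈ Icc 0 R, u₀ < u α t) {Φ : ℝ → ℝ} (hΦ : ContinuousOn Φ (Icc 0 R))
    (hΦe : ∀ r ∈ Icc 0 R, Φ r =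
      1 - volterra (linOuter p n K f (u α)) (linInner n K f u₀ (u α)) Φ r)
    {ε : ℝ} (hε : 0 < ε) :
    ∀ᶠ q : ℝ × ℝ in 𝓝 (α, α), ∀ r ∈ Icc 0 R,
      |mass n K f (u q.1) r - mass n K f (u q.2) r -
        (∫ t in (0:ℝ)..r, linInner n K f u₀ (u α) t * Φ t) * (q.1 - q.2)| ≤
          ε * |q.1 - q.2| := by
  have h := H.ivp α hα
  obtain ⟨C, hC, hk⟩ := h.isVolterraKernel hR fun t ht => hv t ⟨ht.1, ht.2.le⟩
  obtain ⟨M, hM, hlip⟩ := H.exists_eventually_lipschitz hα hR hv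
  obtain ⟨L, hL0, hL⟩ := H.exists_abs_inner_le hα hR.le hv
  set A := ∫ t in (0:ℝ)..R, weight n K t with hA
  have hA0 : 0 < A := h.total_weight_pos hR
  have hgt := H.eventually_gt hα hv
  filter_upwards [hgt.prod_nhds hgt, hlip,
    H.eventually_mass_linearization hα hv (show 0 < ε / (2 * A * M) by positivity),
    H.eventually_strict_deriv hα hR hv hΦ hΦe (show 0 < ε / (2 * A * (L + 1)) by positivity)]
    with q hq hqlip hqm hqs r hr
  have hη : ContinuousOn (fun t => u q.1 t - u q.2 t) (Icc 0 R) :=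
    ((H.ivp q.1 hq.1.1).cont.sub (H.ivp q.2 hq.2.1).cont).mono Icc_subset_Ici_self
  have h1 := hqm _ hqlip r hr
  have h2 := hL (fun t => (u q.1 t - u q.2 t) - (q.1 - q.2) * Φ t)
    (ε / (2 * A * (L + 1)) * |q.1 - q.2|)
    (fun t ht => by rw [mul_comm (q.1 - q.2)]; exact hqs t ht) r hr
  rw [hk.inner_lincomb hη hΦ _ hr] at h2
  have hAr : ∫ t in (0:ℝ)..r, weight n K t ≤ A := by
    refine intervalIntegral.integral_mono_interval le_rfl hr.1 hr.2 ?_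
      ((h.weight_cont.mono Icc_subset_Ici_self).intervalIntegrable_of_Icc hR.le)
    filter_upwards [self_mem_ae_restrict measurableSet_Ioc] with t ht
    exact h.weight_nonneg ht.1.le
  set Ar := ∫ t in (0:ℝ)..r, weight n K t
  set J := ∫ t in (0:ℝ)..r, linInner n K f u₀ (u α) t * (u q.1 t - u q.2 t)
  set P := ∫ t in (0:ℝ)..r, linInner n K f u₀ (u α) t * Φ t
  have h3 : mass n K f (u q.1) r - mass n K f (u q.2) r - P * (q.1 - q.2) =
      (mass n K f (u q.1) r - mass n K f (u q.2) r - J) + (J - (q.1 - q.2) * P) := by ring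
  rw [h3]
  refine (abs_add_le _ _).trans ?_
  have h4 : Ar * (ε / (2 * A * M) * (M * |q.1 - q.2|)) ≤ ε * |q.1 - q.2| / 2 := by
    calc _ ≤ A * (ε / (2 * A * M) * (M * |q.1 - q.2|)) :=
          mul_le_mul_of_nonneg_right hAr (by positivity)
      _ = _ := by field_simp
  have h5 : Ar * (L * (ε / (2 * A * (L + 1)) * |q.1 - q.2|)) ≤ ε * |q.1 - q.2| / 2 := by
    calc _ ≤ A * ((L + 1) * (ε / (2 * A * (L + 1)) * |q.1 - q.2|)) := by
          gcongr
          linarith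
      _ = _ := by field_simp
  linarith

end RadialFamily

theorem hasDerivAt_of_eventually_abs_le {F : ℝ → ℝ} {c α : ℝ}
    (h : ∀ ε > 0, ∀ᶠ q : ℝ × ℝ in 𝓝 (α, α), |F q.1 - F q.2 - c * (q.1 - q.2)| ≤ ε * |q.1 - q.2|) :
    HasDerivAt F c α := by
  refine HasStrictDerivAt.hasDerivAt (hasDerivAtFilter_iff_isLittleO.2 ?_)
  refine Asymptotics.isLittleO_iff.2 fun ε hε => ?_
  filter_upwards [h ε hε] with q hq
  simpa only [Real.norm_eq_abs, smul_eq_mul, mul_comm] using hq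

section UniformStrict

variable {F φ : ℝ → ℝ → ℝ} {O : Set (ℝ × ℝ)}
  (hO : ∀ q ∈ O, 0 ≤ q.2 ∧ ∃ R > q.2, ∀ᶠ β in 𝓝 q.1, ∀ r ∈ Icc 0 R, (β, r) ∈ O)
  (hφ : ∀ α R, 0 < R → (∀ r ∈ Icc 0 R, (α, r) ∈ O) → ContinuousOn (φ α) (Icc 0 R))
  (hs : ∀ α R, 0 < R → (∀ r ∈ Icc 0 R, (α, r) ∈ O) → ∀ ε > 0, ∀ᶠ q : ℝ × ℝ in 𝓝 (α, α),
    ∀ r ∈ Icc 0 R, |F q.1 r - F q.2 r - φ α r * (q.1 - q.2)| ≤ ε * |q.1 - q.2|)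
include hO hφ hs

/-- The partial derivative in the parameter is jointly continuous if it exists in the strict sense,
locally uniformly in the second variable. -/
theorem continuousOn_of_uniform_strict : ContinuousOn (fun q : ℝ × ℝ => φ q.1 q.2) O := by
  rintro ⟨α, r⟩ hq
  obtain ⟨hr0, R, hrR, hev⟩ := hO _ hq
  simp only at hr0 hrR hev
  have hR : 0 < R := hr0.trans_lt hrR
  have hα := hev.self_of_nhds
  rw [ContinuousWithinAt, Metric.tendsto_nhds]
  intro ε hε
  have hdiag : Tendsto (fun β : ℝ => (β, β)) (𝓝 α) (𝓝 (α, α)) :=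
    (by fun_prop : Continuous fun β : ℝ => (β, β)).tendsto α
  have hclose : ∀ᶠ β in 𝓝 α, ∀ ρ ∈ Icc 0 R, |φ β ρ - φ α ρ| ≤ ε / 2 := by
    filter_upwards [hev, hdiag.eventually (hs α R hR hα (ε / 2) (half_pos hε)).eventually_nhds]
      with β hβ hβs ρ hρ
    have hd : HasDerivAt (fun x => F x ρ) (φ β ρ) β :=
      hasDerivAt_of_eventually_abs_le fun δ hδ => by
        filter_upwards [hs β R hR hβ δ hδ] with q hq using hq ρ hρ
    have hd2 : HasDerivAt (fun x => F x ρ - φ α ρ * x) (φ β ρ - φ α ρ) β := by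
      have := hd.sub ((hasDerivAt_id β).const_mul (φ α ρ))
      rwa [mul_one] at this
    refine hd2.le_of_lip' (half_pos hε).le ?_
    have hpair : Tendsto (fun x : ℝ => (x, β)) (𝓝 β) (𝓝 (β, β)) :=
      (by fun_prop : Continuous fun x : ℝ => (x, β)).tendsto β
    filter_upwards [hpair.eventually hβs] with x hx
    have := hx ρ hρ
    rw [Real.norm_eq_abs, Real.norm_eq_abs]
    refine le_trans (le_of_eq ?_) this
    congr 1
    ring
  have h1 : Tendsto Prod.fst (𝓝[O] (α, r)) (𝓝 α) :=
    (continuous_fst.tendsto (α, r)).mono_left nhdsWithin_le_nhds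
  have h2 : Tendsto Prod.snd (𝓝[O] (α, r)) (𝓝[Icc 0 R] r) := by
    refine tendsto_nhdsWithin_iff.2
      ⟨(continuous_snd.tendsto (α, r)).mono_left nhdsWithin_le_nhds, ?_⟩
    filter_upwards [self_mem_nhdsWithin, nhdsWithin_le_nhds
      ((continuous_snd.tendsto (α, r)).eventually (gt_mem_nhds hrR))] with q hqO hqR
    exact ⟨(hO q hqO).1, hqR.le⟩
  have h3 := (hφ α R hR hα r ⟨hr0, hrR.le⟩).tendsto.eventually
    (Metric.ball_mem_nhds _ (half_pos hε))
  filter_upwards [h1.eventually hclose, h2.eventually h3,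
    h2.eventually self_mem_nhdsWithin] with q hq1 hq3 hq2
  have h4 : |φ α q.2 - φ α r| < ε / 2 := hq3
  rw [Real.dist_eq]
  have h5 := abs_add_le (φ q.1 q.2 - φ α q.2) (φ α q.2 - φ α r)
  rw [sub_add_sub_cancel] at h5
  linarith [hq1 q.2 hq2]

/-- A criterion for `F` to be `C¹`: strict differentiability in the parameter, locally uniform in
the second variable, together with a jointly continuous derivative in the second variable. -/
theorem contDiffOn_one_of_uniform_strict {G : ℝ → ℝ → ℝ}
    (hF : ∀ q ∈ O, HasDerivWithinAt (F q.1) (G q.1 q.2) (Ici 0) q.2)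
    (hG : ContinuousOn (fun q : ℝ × ℝ => G q.1 q.2) O) :
    ContDiffOn ℝ 1 (fun q : ℝ × ℝ => F q.1 q.2) O := by
  have hφc := continuousOn_of_uniform_strict hO hφ hs
  rw [show (1 : WithTop ℕ∞) = 0 + 1 from (zero_add 1).symm,
    contDiffOn_succ_iff_hasFDerivWithinAt (by simp)]
  intro q₀ hq₀
  rw [insert_eq_of_mem hq₀]
  refine ⟨O, self_mem_nhdsWithin, by simp, fun q => φ q.1 q.2 • ContinuousLinearMap.fst ℝ ℝ ℝ +
    G q.1 q.2 • ContinuousLinearMap.snd ℝ ℝ ℝ, ?_, ?_⟩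
  swap
  · rw [contDiffOn_zero]
    exact (hφc.smul continuousOn_const).add (hG.smul continuousOn_const)
  rintro ⟨α, r⟩ hq
  obtain ⟨hr0, R, hrR, hev⟩ := hO _ hq
  simp only at hr0 hrR hev
  have hR : 0 < R := hr0.trans_lt hrR
  have hα := hev.self_of_nhds
  rw [hasFDerivWithinAt_iff_isLittleO, Asymptotics.isLittleO_iff]
  intro ε hε
  have hε3 : 0 < ε / 3 := by positivity
  have h2 : Tendsto Prod.snd (𝓝[O] (α, r)) (𝓝[Icc 0 R] r) := by
    refine tendsto_nhdsWithin_iff.2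
      ⟨(continuous_snd.tendsto (α, r)).mono_left nhdsWithin_le_nhds, ?_⟩
    filter_upwards [self_mem_nhdsWithin, nhdsWithin_le_nhds
      ((continuous_snd.tendsto (α, r)).eventually (gt_mem_nhds hrR))] with q hqO hqR
    exact ⟨(hO q hqO).1, hqR.le⟩
  have h1 : Tendsto (fun q : ℝ × ℝ => (q.1, α)) (𝓝[O] (α, r)) (𝓝 (α, α)) :=
    ((by fun_prop : Continuous fun q : ℝ × ℝ => (q.1, α)).tendsto (α, r)).mono_left
      nhdsWithin_le_nhds
  have h3 := (hφ α R hR hα r ⟨hr0, hrR.le⟩).tendsto.eventually (Metric.ball_mem_nhds _ hε3)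
  have h4 := (hasDerivWithinAt_iff_isLittleO.1 ((hF _ hq).mono
    (Icc_subset_Ici_self : Icc 0 R ⊆ Ici 0))).def hε3
  filter_upwards [h1.eventually (hs α R hR hα _ hε3), h2.eventually h3, h2.eventually h4,
    h2.eventually self_mem_nhdsWithin] with q hq1 hq3 hq4 hq2
  have e1 : |F q.1 q.2 - F α q.2 - φ α q.2 * (q.1 - α)| ≤ ε / 3 * |q.1 - α| := hq1 q.2 hq2
  have e3 : |φ α q.2 - φ α r| < ε / 3 := hq3
  have e4 : |F α q.2 - F α r - (q.2 - r) * G α r| ≤ ε / 3 * |q.2 - r| := hq4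
  have n1 : |q.1 - α| ≤ ‖q - (α, r)‖ := norm_fst_le (q - (α, r))
  have n2 : |q.2 - r| ≤ ‖q - (α, r)‖ := norm_snd_le (q - (α, r))
  have e5 : |(φ α q.2 - φ α r) * (q.1 - α)| ≤ ε / 3 * |q.1 - α| := by
    rw [abs_mul]
    exact mul_le_mul_of_nonneg_right e3.le (abs_nonneg _)
  have hsplit : F q.1 q.2 - F α r - (φ α r * (q.1 - α) + G α r * (q.2 - r)) =
      (F q.1 q.2 - F α q.2 - φ α q.2 * (q.1 - α)) + (φ α q.2 - φ α r) * (q.1 - α) +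
        (F α q.2 - F α r - (q.2 - r) * G α r) := by ring
  have e6 := (abs_add_le ((F q.1 q.2 - F α q.2 - φ α q.2 * (q.1 - α)) +
    (φ α q.2 - φ α r) * (q.1 - α)) (F α q.2 - F α r - (q.2 - r) * G α r)).trans
      (add_le_add_left (abs_add_le _ _) _)
  rw [← hsplit] at e6
  have e7 := mul_le_mul_of_nonneg_left n1 hε3.le
  have e8 := mul_le_mul_of_nonneg_left n2 hε3.le
  change |F q.1 q.2 - F α r - (φ α r * (q.1 - α) + G α r * (q.2 - r))| ≤ ε * ‖q - (α, r)‖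
  linarith

end UniformStrict

namespace IsVolterraKernel

variable {R C : ℝ} {B κ η : ℝ → ℝ}

theorem hasDerivWithinAt_volterra (hk : IsVolterraKernel R C B κ)
    (hη : ContinuousOn η (Icc 0 R)) {r : ℝ} (hr : r ∈ Ioc 0 R) :
    HasDerivWithinAt (volterra B κ η) (B r * ∫ t in (0:ℝ)..r, κ t * η t) (Icc 0 R) r := by
  have hr' : r ∈ Icc 0 R := Ioc_subset_Icc_self hr
  have : Fact (r ∈ Icc 0 R) := ⟨hr'⟩
  have hmem : Ioc 0 R ∈ 𝓝[Icc 0 R] r := by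
    filter_upwards [self_mem_nhdsWithin, nhdsWithin_le_nhds (Ioi_mem_nhds hr.1)] with x hx hx0
    exact ⟨hx0, hx.2⟩
  have hc := hk.continuousOn_integrand hη
  exact intervalIntegral.integral_hasDerivWithinAt_right (hk.intervalIntegrable_integrand hη hr')
    ⟨_, hmem, hc.aestronglyMeasurable measurableSet_Ioc⟩ ((hc r hr).mono_of_mem_nhdsWithin hmem)

theorem hasDerivAt_primitive (hk : IsVolterraKernel R C B κ)
    (hη : ContinuousOn η (Icc 0 R)) {r : ℝ} (hr : r ∈ Ioo 0 R) :
    HasDerivAt (fun s => ∫ t in (0:ℝ)..s, κ t * η t) (κ r * η r) r := by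
  have hc := hk.continuousOn_inner.mul hη
  have hmem : Icc 0 R ∈ 𝓝 r := Icc_mem_nhds hr.1 hr.2
  exact intervalIntegral.integral_hasDerivAt_right
    (hc.intervalIntegrable_of_mem_Icc (Ioo_subset_Icc_self hr))
    ⟨_, hmem, hc.aestronglyMeasurable measurableSet_Icc⟩ (hc.continuousAt hmem)

end IsVolterraKernel

namespace RadialIVP

variable {p : ℝ} {n : ℕ} {K f : ℝ → ℝ} {u₀ α : ℝ} {v : ℝ → ℝ}
  (h : RadialIVP p n K f u₀ α v)
include h

theorem exists_gt_forall_Icc {r : ℝ} (hr : 0 ≤ r) (hv : ∀ t ∈ Icc 0 r, u₀ < v t) :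
    ∃ R > r, ∀ t ∈ Icc 0 R, u₀ < v t := by
  have h1 : ∀ᶠ t in 𝓝[Ici 0] r, u₀ < v t :=
    (h.cont r hr).tendsto.eventually (lt_mem_nhds (hv r ⟨hr, le_rfl⟩))
  obtain ⟨ε, hε, hball⟩ := Metric.eventually_nhds_iff.1 (eventually_nhdsWithin_iff.1 h1)
  refine ⟨r + ε / 2, by linarith, fun t ht => ?_⟩
  rcases le_or_gt t r with htr | htr
  · exact hv t ⟨ht.1, htr⟩
  · refine hball ?_ ht.1
    rw [Real.dist_eq, abs_of_pos (sub_pos.2 htr)]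
    linarith [ht.2]

theorem ofReal_lt_Rend_iff (hu₀ : 0 < u₀) {r : ℝ} (hr : 0 ≤ r) :
    (ENNReal.ofReal r < Rend v ∧ u₀ < v r) ↔ ∀ t ∈ Icc 0 r, u₀ < v t := by
  constructor
  · rintro ⟨h1, h2⟩ t ht
    obtain ⟨R, hR, hrR⟩ := lt_sSup_iff.1 h1
    have hanti : AntitoneOn v (Icc 0 r) := by
      refine antitoneOn_of_deriv_nonpos (convex_Icc 0 r) (h.cont.mono Icc_subset_Ici_self) ?_ ?_
      · rw [interior_Icc]
        exact fun x hx => (h.hasDerivAt hx.1).differentiableAt.differentiableWithinAt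
      · rw [interior_Icc]
        intro x hx
        rw [(h.hasDerivAt hx.1).deriv]
        exact (hR x hx.1 ((ENNReal.ofReal_le_ofReal hx.2.le).trans_lt hrR)).2.le
    exact h2.trans_le (hanti ht ⟨hr, le_rfl⟩ ht.2)
  · intro hv
    refine ⟨?_, hv r ⟨hr, le_rfl⟩⟩
    obtain ⟨R, hrR, hR⟩ := h.exists_gt_forall_Icc hr hv
    have hR0 : 0 < R := hr.trans_lt hrR
    refine lt_of_lt_of_le ((ENNReal.ofReal_lt_ofReal_iff hR0).2 hrR)
      (le_sSup (show ENNReal.ofReal R ∈ {R : ℝ≥0∞ | _} from fun t ht htR => ?_))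
    have htR' := (ENNReal.ofReal_lt_ofReal_iff hR0).1 htR
    exact ⟨hu₀.trans (hR t ⟨ht.le, htR'.le⟩),
      h.uderiv_neg ht fun s hs => hR s ⟨hs.1, hs.2.le.trans htR'.le⟩⟩

theorem tInv_spec (hne : {r : ℝ | 0 ≤ r ∧ v r = u₀}.Nonempty) :
    0 < tInv v u₀ ∧ ∀ t ∈ Ico 0 (tInv v u₀), u₀ < v t := by
  have hcl : IsClosed {r : ℝ | 0 ≤ r ∧ v r = u₀} :=
    h.cont.preimage_isClosed_of_isClosed isClosed_Ici (isClosed_singleton (x := u₀))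
  have hbdd : BddBelow {r : ℝ | 0 ≤ r ∧ v r = u₀} := ⟨0, fun r hr => hr.1⟩
  have hmem := hcl.csInf_mem hne hbdd
  have hne0 : tInv v u₀ ≠ 0 := fun h0 => by
    have : v (tInv v u₀) = u₀ := hmem.2
    rw [h0, h.init] at this
    exact h.lt_init.ne' this
  refine ⟨lt_of_le_of_ne hmem.1 hne0.symm, fun t ht => ?_⟩
  by_contra! hle
  have hiv := intermediate_value_Icc' ht.1 (h.cont.mono Icc_subset_Ici_self)
  obtain ⟨s, hs, hsv⟩ := hiv ⟨hle, by rw [h.init]; exact h.lt_init.le⟩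
  exact (csInf_le hbdd ⟨hs.1, hsv⟩).not_gt (hs.2.trans_lt ht.2)

theorem exists_linearized_solution {R : ℝ} (hR : 0 < R) (hv : ∀ t ∈ Ico 0 R, u₀ < v t) :
    ∃ Φ : ℝ → ℝ, ContinuousOn Φ (Icc 0 R) ∧ ∀ r ∈ Icc 0 R,
      Φ r = 1 - volterra (linOuter p n K f v) (linInner n K f u₀ v) Φ r := by
  obtain ⟨C, hC, hk⟩ := h.isVolterraKernel hR hv
  exact hk.exists_solution hC hR.le

end RadialIVP

namespace RadialFamily

variable {p : ℝ} {n : ℕ} {K f : ℝ → ℝ} {u₀ : ℝ} {u : ℝ → ℝ → ℝ}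
  (H : RadialFamily p n K f u₀ u) {α : ℝ}
include H

theorem mem_Oset (hu₀ : 0 < u₀) {q : ℝ × ℝ} :
    q ∈ Oset u u₀ ↔ u₀ < q.1 ∧ 0 ≤ q.2 ∧ ∀ t ∈ Icc 0 q.2, u₀ < u q.1 t :=
  and_congr_right fun h1 => and_congr_right fun h2 => (H.ivp q.1 h1).ofReal_lt_Rend_iff hu₀ h2

theorem Oset_nhds (hu₀ : 0 < u₀) {q : ℝ × ℝ} (hq : q ∈ Oset u u₀) :
    0 ≤ q.2 ∧ ∃ R > q.2, ∀ᶠ β in 𝓝 q.1, ∀ r ∈ Icc 0 R, (β, r) ∈ Oset u u₀ := by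
  obtain ⟨h1, h2, h3⟩ := (H.mem_Oset hu₀).1 hq
  obtain ⟨R, hR, hv⟩ := (H.ivp _ h1).exists_gt_forall_Icc h2 h3
  refine ⟨h2, R, hR, ?_⟩
  filter_upwards [H.eventually_gt h1 hv] with β hβ r hr
  exact (H.mem_Oset hu₀).2 ⟨hβ.1, hr.1, fun t ht => hβ.2 t ⟨ht.1, ht.2.trans hr.2⟩⟩

section Linearized

variable {R : ℝ} {Φ : ℝ → ℝ} (hα : u₀ < α) (hR : 0 < R) (hv : ∀ t ∈ Ico 0 R, u₀ < u α t)
  (hΦ : ContinuousOn Φ (Icc 0 R))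
  (hΦe : ∀ r ∈ Icc 0 R, Φ r =
    1 - volterra (linOuter p n K f (u α)) (linInner n K f u₀ (u α)) Φ r)
include hα hv hΦ hΦe

theorem hasDerivAt_init {r : ℝ} (hr : r ∈ Ico 0 R) : HasDerivAt (fun β => u β r) (Φ r) α := by
  obtain ⟨R', hr', hR'⟩ := exists_between hr.2
  refine hasDerivAt_of_eventually_abs_le fun ε hε => ?_
  filter_upwards [H.eventually_strict_deriv hα (hr.1.trans_lt hr')
    (fun t ht => hv t ⟨ht.1, ht.2.trans_lt hR'⟩) (hΦ.mono (Icc_subset_Icc_right hR'.le))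
    (fun t ht => hΦe t ⟨ht.1, ht.2.trans hR'.le⟩) hε] with q hq
  exact hq r ⟨hr.1, hr'.le⟩

theorem hasDerivAt_mass {r : ℝ} (hr : r ∈ Ico 0 R) :
    HasDerivAt (fun β => mass n K f (u β) r)
      (∫ t in (0:ℝ)..r, linInner n K f u₀ (u α) t * Φ t) α := by
  obtain ⟨R', hr', hR'⟩ := exists_between hr.2
  refine hasDerivAt_of_eventually_abs_le fun ε hε => ?_
  filter_upwards [H.eventually_strict_deriv_mass hα (hr.1.trans_lt hr')
    (fun t ht => hv t ⟨ht.1, ht.2.trans_lt hR'⟩) (hΦ.mono (Icc_subset_Icc_right hR'.le))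
    (fun t ht => hΦe t ⟨ht.1, ht.2.trans hR'.le⟩) hε] with q hq
  exact hq r ⟨hr.1, hr'.le⟩

theorem hasDerivAt_flux {r : ℝ} (hr : r ∈ Ico 0 R) :
    HasDerivAt (fun β => flux p n (u β) r)
      (-∫ t in (0:ℝ)..r, linInner n K f u₀ (u α) t * Φ t) α := by
  refine (H.hasDerivAt_mass hα hv hΦ hΦe hr).neg.congr_of_eventuallyEq ?_
  filter_upwards [H.eventually_gt hα fun t (ht : t ∈ Icc 0 r) =>
    hv t ⟨ht.1, ht.2.trans_lt hr.2⟩] with β hβ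
  exact (H.ivp β hβ.1).flux_eq_neg_mass hr.1 fun t ht => (hβ.2 t ht).le

theorem hasDerivAt_uderiv {r : ℝ} (hr : r ∈ Ioo 0 R) :
    HasDerivAt (fun β => uderiv (u β) r) (-(linOuter p n K f (u α) r *
      ∫ t in (0:ℝ)..r, linInner n K f u₀ (u α) t * Φ t)) α := by
  have h := H.ivp α hα
  have hvr : ∀ t ∈ Ico 0 r, u₀ < u α t := fun t ht => hv t ⟨ht.1, ht.2.trans hr.2⟩
  have hm := h.mass_pos hr.1 hvr
  have hrn : 0 < r ^ (n - 1) := pow_pos hr.1 _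
  have h1 := ((((H.hasDerivAt_mass hα hv hΦ hΦe ⟨hr.1.le, hr.2⟩).div_const
    (r ^ (n - 1))).rpow_const (p := 1 / (p - 1)) (Or.inl (div_pos hm hrn).ne')).neg)
  have h2 : (fun β => uderiv (u β) r) =ᶠ[𝓝 α]
      fun β => -(mass n K f (u β) r / r ^ (n - 1)) ^ (1 / (p - 1)) := by
    filter_upwards [H.eventually_gt hα fun t (ht : t ∈ Icc 0 r) =>
      hv t ⟨ht.1, ht.2.trans_lt hr.2⟩] with β hβ
    exact (H.ivp β hβ.1).uderiv_eq hr.1 fun t ht => hβ.2 t ⟨ht.1, ht.2.le⟩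
  refine (h1.congr_of_eventuallyEq h2).congr_deriv ?_
  rw [linOuter, abs_of_neg (h.uderiv_neg hr.1 hvr), h.uderiv_eq hr.1 hvr, neg_neg,
    Real.rpow_sub_one (div_pos hm hrn).ne']
  field_simp

theorem hasDerivAt_deriv_init {r : ℝ} (hr : r ∈ Ioo 0 R) :
    HasDerivAt (fun ρ => deriv (fun β => u β ρ) α) (-(linOuter p n K f (u α) r *
      ∫ t in (0:ℝ)..r, linInner n K f u₀ (u α) t * Φ t)) r := by
  obtain ⟨C, -, hk⟩ := (H.ivp α hα).isVolterraKernel (hr.1.trans hr.2) hv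
  have h1 := ((hk.hasDerivWithinAt_volterra hΦ ⟨hr.1, hr.2.le⟩).hasDerivAt
    (Icc_mem_nhds hr.1 hr.2)).const_sub 1
  refine h1.congr_of_eventuallyEq ?_
  filter_upwards [Ioo_mem_nhds hr.1 hr.2] with ρ hρ
  rw [(H.hasDerivAt_init hα hv hΦ hΦe ⟨hρ.1.le, hρ.2⟩).deriv]
  exact hΦe ρ ⟨hρ.1.le, hρ.2.le⟩

theorem mul_deriv_deriv_init {r : ℝ} (hr : r ∈ Ioo 0 R) :
    r ^ (n - 1) * |uderiv (u α) r| ^ (p - 2) * deriv (fun ρ => deriv (fun β => u β ρ) α) r =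
      -(1 / (p - 1) * ∫ t in (0:ℝ)..r, linInner n K f u₀ (u α) t * Φ t) := by
  rw [(H.hasDerivAt_deriv_init hα hv hΦ hΦe hr).deriv,
    ← (H.ivp α hα).mul_linOuter hr.1 fun t ht => hv t ⟨ht.1, ht.2.trans hr.2⟩]
  ring

theorem hasDerivAt_mul_deriv_deriv_init {r : ℝ} (hr : r ∈ Ioo 0 R) :
    HasDerivAt (fun ρ => ρ ^ (n - 1) * |uderiv (u α) ρ| ^ (p - 2) *
        deriv (fun ρ' => deriv (fun β => u β ρ') α) ρ)
      (-(r ^ (n - 1) * K r * fder f u₀ (u α r) * deriv (fun β => u β r) α) / (p - 1)) r := by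
  obtain ⟨C, -, hk⟩ := (H.ivp α hα).isVolterraKernel (hr.1.trans hr.2) hv
  have h1 := ((hk.hasDerivAt_primitive hΦ hr).const_mul (1 / (p - 1))).neg
  rw [(H.hasDerivAt_init hα hv hΦ hΦe ⟨hr.1.le, hr.2⟩).deriv]
  have h2 := h1.congr_of_eventuallyEq (f₁ := fun ρ => ρ ^ (n - 1) * |uderiv (u α) ρ| ^ (p - 2) *
    deriv (fun ρ' => deriv (fun β => u β ρ') α) ρ) (by
      filter_upwards [Ioo_mem_nhds hr.1 hr.2] with ρ hρ
      exact H.mul_deriv_deriv_init hα hv hΦ hΦe hρ)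
  refine h2.congr_deriv ?_
  rw [linInner, weight]
  ring

include hR in
theorem tendsto_mul_deriv_deriv_init :
    Tendsto (fun r => r ^ (n - 1) * |uderiv (u α) r| ^ (p - 2) *
      deriv (fun ρ => deriv (fun β => u β ρ) α) r) (𝓝[>] 0) (𝓝 0) := by
  obtain ⟨C, -, hk⟩ := (H.ivp α hα).isVolterraKernel hR hv
  have h1 := ((hk.continuousOn_primitive hΦ 0 ⟨le_rfl, hR.le⟩).const_mul (1 / (p - 1))).neg
  have h2 := h1.tendsto.mono_left (nhdsWithin_le_of_mem (Icc_mem_nhdsGT hR))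
  simp only [Pi.neg_apply, intervalIntegral.integral_same, mul_zero, neg_zero] at h2
  refine h2.congr' ?_
  filter_upwards [Ioo_mem_nhdsGT hR] with r hr
  exact (H.mul_deriv_deriv_init hα hv hΦ hΦe hr).symm

end Linearized

theorem exists_linearized_beyond {R : ℝ} (hα : u₀ < α) (hR : 0 ≤ R)
    (hv : ∀ t ∈ Icc 0 R, u₀ < u α t) :
    ∃ R' > R, (∀ t ∈ Ico 0 R', u₀ < u α t) ∧ ∃ Φ : ℝ → ℝ, ContinuousOn Φ (Icc 0 R') ∧
      ∀ r ∈ Icc 0 R', Φ r =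
        1 - volterra (linOuter p n K f (u α)) (linInner n K f u₀ (u α)) Φ r := by
  obtain ⟨R', hRR', hv'⟩ := (H.ivp α hα).exists_gt_forall_Icc hR hv
  have hv'' : ∀ t ∈ Ico 0 R', u₀ < u α t := fun t ht => hv' t ⟨ht.1, ht.2.le⟩
  exact ⟨R', hRR', hv'', (H.ivp α hα).exists_linearized_solution (hR.trans_lt hRR') hv''⟩

theorem contDiffOn_Oset (hu₀ : 0 < u₀) :
    ContDiffOn ℝ 1 (fun q : ℝ × ℝ => u q.1 q.2) (Oset u u₀) := by
  have hsub : Oset u u₀ ⊆ Ioi u₀ ×ˢ Ici 0 := fun q hq => ⟨hq.1, hq.2.1⟩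
  refine contDiffOn_one_of_uniform_strict (φ := fun α r => deriv (fun β => u β r) α)
    (G := fun α r => uderiv (u α) r) (fun q hq => H.Oset_nhds hu₀ hq) ?_ ?_
    (fun q hq => (H.ivp q.1 hq.1).hasDerivWithinAt hq.2.1) (H.cont_uderiv.mono hsub)
  · intro α R hR hO
    obtain ⟨hα, -, hv⟩ := (H.mem_Oset hu₀).1 (hO R ⟨hR.le, le_rfl⟩)
    obtain ⟨R', hRR', hv', Φ, hΦ, hΦe⟩ := H.exists_linearized_beyond hα hR.le hv
    refine (hΦ.mono (Icc_subset_Icc_right hRR'.le)).congr fun r hr => ?_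
    exact (H.hasDerivAt_init hα hv' hΦ hΦe ⟨hr.1, hr.2.trans_lt hRR'⟩).deriv
  · intro α R hR hO ε hε
    obtain ⟨hα, -, hv⟩ := (H.mem_Oset hu₀).1 (hO R ⟨hR.le, le_rfl⟩)
    obtain ⟨R', hRR', hv', Φ, hΦ, hΦe⟩ := H.exists_linearized_beyond hα hR.le hv
    filter_upwards [H.eventually_strict_deriv hα hR hv
      (hΦ.mono (Icc_subset_Icc_right hRR'.le))
      (fun r hr => hΦe r ⟨hr.1, hr.2.trans hRR'.le⟩) hε] with q hq r hr
    rw [(H.hasDerivAt_init hα hv' hΦ hΦe ⟨hr.1, hr.2.trans_lt hRR'⟩).deriv]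
    exact hq r hr

theorem contDiffOn_flux_Oset (hu₀ : 0 < u₀) :
    ContDiffOn ℝ 1 (fun q : ℝ × ℝ => flux p n (u q.1) q.2) (Oset u u₀) := by
  have hsub : Oset u u₀ ⊆ Ioi u₀ ×ˢ Ici 0 := fun q hq => ⟨hq.1, hq.2.1⟩
  rcases (Oset u u₀).eq_empty_or_nonempty with he | ⟨q₀, hq₀⟩
  · rw [he]
    exact contDiffOn_empty
  have h0 := H.ivp q₀.1 hq₀.1
  refine contDiffOn_one_of_uniform_strict (F := fun α r => flux p n (u α) r)
    (φ := fun α r => deriv (fun β => flux p n (u β) r) α)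
    (G := fun α r => -(weight n K r * f (u α r))) (fun q hq => H.Oset_nhds hu₀ hq) ?_ ?_
    (fun q hq => (H.ivp q.1 hq.1).flux_hasDerivWithinAt hq.2.1)
    ((h0.weight_cont.comp continuousOn_snd fun q hq => hq.2.1).mul
      (h0.f_cont.comp (H.cont.mono hsub) fun q hq => hq.2.2.2.le)).neg
  · intro α R hR hO
    obtain ⟨hα, -, hv⟩ := (H.mem_Oset hu₀).1 (hO R ⟨hR.le, le_rfl⟩)
    obtain ⟨R', hRR', hv', Φ, hΦ, hΦe⟩ := H.exists_linearized_beyond hα hR.le hv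
    obtain ⟨C, -, hk⟩ := (H.ivp α hα).isVolterraKernel (hR.trans hRR') hv'
    refine ((hk.continuousOn_primitive hΦ).mono
      (Icc_subset_Icc_right hRR'.le)).neg.congr fun r hr => ?_
    exact (H.hasDerivAt_flux hα hv' hΦ hΦe ⟨hr.1, hr.2.trans_lt hRR'⟩).deriv
  · intro α R hR hO ε hε
    obtain ⟨hα, -, hv⟩ := (H.mem_Oset hu₀).1 (hO R ⟨hR.le, le_rfl⟩)
    obtain ⟨R', hRR', hv', Φ, hΦ, hΦe⟩ := H.exists_linearized_beyond hα hR.le hv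
    have hgt := H.eventually_gt hα hv
    filter_upwards [hgt.prod_nhds hgt, H.eventually_strict_deriv_mass hα hR hv
      (hΦ.mono (Icc_subset_Icc_right hRR'.le))
      (fun r hr => hΦe r ⟨hr.1, hr.2.trans hRR'.le⟩) hε] with q hqv hq r hr
    have hflux : ∀ β, (u₀ < β ∧ ∀ t ∈ Icc 0 R, u₀ < u β t) →
        flux p n (u β) r = -mass n K f (u β) r := fun β hβ =>
      (H.ivp β hβ.1).flux_eq_neg_mass hr.1 fun t ht => (hβ.2 t ⟨ht.1, ht.2.trans hr.2⟩).le
    rw [(H.hasDerivAt_flux hα hv' hΦ hΦe ⟨hr.1, hr.2.trans_lt hRR'⟩).deriv,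
      hflux _ hqv.1, hflux _ hqv.2, ← abs_neg]
    refine le_trans (le_of_eq ?_) (hq r hr)
    congr 1
    ring

theorem exists_linearized_continuation (hα : u₀ < α)
    (hne : {r : ℝ | 0 ≤ r ∧ u α r = u₀}.Nonempty) :
    ∃ Φ Ψ : ℝ → ℝ,
      ContinuousOn Φ (Icc 0 (tInv (u α) u₀)) ∧
      ContinuousOn Ψ (Icc 0 (tInv (u α) u₀)) ∧
      (∀ r ∈ Ico (0:ℝ) (tInv (u α) u₀), Φ r = deriv (fun β => u β r) α) ∧
      (∀ r ∈ Ioo (0:ℝ) (tInv (u α) u₀),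
        Ψ r = r ^ (n - 1) * |uderiv (u α) r| ^ (p - 2) *
          deriv (fun ρ => deriv (fun β => u β ρ) α) r) ∧
      HasDerivWithinAt Φ
        (Ψ (tInv (u α) u₀) /
          ((tInv (u α) u₀) ^ (n - 1) * |uderiv (u α) (tInv (u α) u₀)| ^ (p - 2)))
        (Iic (tInv (u α) u₀)) (tInv (u α) u₀) := by
  have h := H.ivp α hα
  obtain ⟨hR, hv⟩ := h.tInv_spec hne
  set R := tInv (u α) u₀
  obtain ⟨Φ, hΦ, hΦe⟩ := h.exists_linearized_solution hR hv
  obtain ⟨C, -, hk⟩ := h.isVolterraKernel hR hv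
  refine ⟨Φ, fun r => -(1 / (p - 1) * ∫ t in (0:ℝ)..r, linInner n K f u₀ (u α) t * Φ t), hΦ,
    (continuousOn_const.mul (hk.continuousOn_primitive hΦ)).neg,
    fun r hr => (H.hasDerivAt_init hα hv hΦ hΦe hr).deriv.symm,
    fun r hr => (H.mul_deriv_deriv_init hα hv hΦ hΦe hr).symm, ?_⟩
  have hRR : R ∈ Icc 0 R := ⟨hR.le, le_rfl⟩
  have h1 := ((hk.hasDerivWithinAt_volterra hΦ ⟨hR, le_rfl⟩).const_sub 1).congr hΦe (hΦe R hRR)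
  have h2 := h1.mono_of_mem_nhdsWithin (Icc_mem_nhdsLE hR)
  refine h2.congr_deriv ?_
  have hD : 0 < R ^ (n - 1) * |uderiv (u α) R| ^ (p - 2) :=
    mul_pos (pow_pos hR _) (Real.rpow_pos_of_pos (abs_pos.2 (h.uderiv_neg hR hv).ne) _)
  rw [eq_div_iff hD.ne', ← h.mul_linOuter hR hv]
  ring

end RadialFamily

/-- Lemma 2.2: differentiability of `u` and `r^{n-1}φ_p(u')` with respect to the
initial value, and the linearized equation satisfied by `φ = ∂u/∂α`. -/
theorem differentiability_in_initial_value
    (p : ℝ) (n : ℕ) (hp : 1 < p) (hn : p < n)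
    (K f : ℝ → ℝ) (u₀ : ℝ) (hu₀ : 0 < u₀)
    (hK : CondK1 p K) (hf1 : CondF1 f u₀) (hf2 : CondF2 f u₀)
    (hfC1 : ContDiffOn ℝ 1 f (Ici u₀))
    (u : ℝ → ℝ → ℝ) (hfam : IsFamily p n K f u₀ u) :
    ContDiffOn ℝ 1 (fun q : ℝ × ℝ => u q.1 q.2) (Oset u u₀) ∧
    ContDiffOn ℝ 1 (fun q : ℝ × ℝ => q.2 ^ (n - 1) * phiP p (uderiv (u q.1) q.2))
      (Oset u u₀) ∧
    (∀ α : ℝ, u₀ < α → deriv (fun β => u β 0) α = 1) ∧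
    (∀ α r : ℝ, (α, r) ∈ Oset u u₀ → 0 < r →
      deriv (fun β => uderiv (u β) r) α =
        deriv (fun ρ => deriv (fun β => u β ρ) α) r) ∧
    (∀ α : ℝ, u₀ < α →
      Tendsto
        (fun r => r ^ (n - 1) * |uderiv (u α) r| ^ (p - 2) *
          deriv (fun ρ => deriv (fun β => u β ρ) α) r)
        (𝓝[>] 0) (𝓝 0)) ∧
    (∀ α r : ℝ, (α, r) ∈ Oset u u₀ → 0 < r →
      HasDerivAt
        (fun ρ => ρ ^ (n - 1) * |uderiv (u α) ρ| ^ (p - 2) *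
          deriv (fun ρ' => deriv (fun β => u β ρ') α) ρ)
        (-(r ^ (n - 1) * K r * fder f u₀ (u α r) * deriv (fun β => u β r) α) / (p - 1))
        r) ∧
    (∀ α : ℝ, u₀ < α → {r : ℝ | 0 ≤ r ∧ u α r = u₀}.Nonempty →
      ∃ Φ Ψ : ℝ → ℝ,
        ContinuousOn Φ (Icc 0 (tInv (u α) u₀)) ∧
        ContinuousOn Ψ (Icc 0 (tInv (u α) u₀)) ∧
        (∀ r ∈ Ico (0:ℝ) (tInv (u α) u₀), Φ r = deriv (fun β => u β r) α) ∧
        (∀ r ∈ Ioo (0:ℝ) (tInv (u α) u₀),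
          Ψ r = r ^ (n - 1) * |uderiv (u α) r| ^ (p - 2) *
            deriv (fun ρ => deriv (fun β => u β ρ) α) r) ∧
        HasDerivWithinAt Φ
          (Ψ (tInv (u α) u₀) /
            ((tInv (u α) u₀) ^ (n - 1) * |uderiv (u α) (tInv (u α) u₀)| ^ (p - 2)))
          (Iic (tInv (u α) u₀)) (tInv (u α) u₀)) := by
  have H : RadialFamily p n K f u₀ u :=
    { ivp := fun α hα =>
        { one_lt := hp
          lt_dim := hn
          K_pos := hK.1
          K_cont := hK.2.1.continuousOn
          f_pos := hf1.2.1
          f_contDiff := hfC1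
          lt_init := hα
          sol := (hfam.1 α hα).1
          init := (hfam.1 α hα).2.1
          init_deriv := (hfam.1 α hα).2.2 }
      cont := hfam.2.1
      cont_uderiv := hfam.2.2 }
  refine ⟨H.contDiffOn_Oset hu₀, H.contDiffOn_flux_Oset hu₀, fun α hα => ?_, fun α r hO hr => ?_,
    fun α hα => ?_, fun α r hO hr => ?_, fun α hα hne => H.exists_linearized_continuation hα hne⟩
  · have h1 : (fun β => u β 0) =ᶠ[𝓝 α] fun β => β := by
      filter_upwards [lt_mem_nhds hα] with β hβ using (H.ivp β hβ).init
    rw [h1.deriv_eq, deriv_id'']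
  · obtain ⟨hα, -, hv⟩ := (H.mem_Oset hu₀).1 hO
    obtain ⟨R, hR, hv', Φ, hΦ, hΦe⟩ := H.exists_linearized_beyond hα hr.le hv
    rw [(H.hasDerivAt_uderiv hα hv' hΦ hΦe ⟨hr, hR⟩).deriv,
      (H.hasDerivAt_deriv_init hα hv' hΦ hΦe ⟨hr, hR⟩).deriv]
  · have hv : ∀ t ∈ Icc (0:ℝ) 0, u₀ < u α t := fun t ht => by
      rwa [le_antisymm ht.2 ht.1, (H.ivp α hα).init]
    obtain ⟨R, hR, hv', Φ, hΦ, hΦe⟩ := H.exists_linearized_beyond hα le_rfl hv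
    exact H.tendsto_mul_deriv_deriv_init hα hR hv' hΦ hΦe
  · obtain ⟨hα, -, hv⟩ := (H.mem_Oset hu₀).1 hO
    obtain ⟨R, hR, hv', Φ, hΦ, hΦe⟩ := H.exists_linearized_beyond hα hr.le hv
    exact H.hasDerivAt_mul_deriv_deriv_init hα hv' hΦ hΦe ⟨hr, hR⟩
end
end

section
/- Assume K satisfies (K1) and f satisfies (f1) and (f2). Let α₁ ∈ G∪N and α₂>u₀, and assume u(·,α₂) attains the value u₀. If t(u₀,α₂) ≤ t(u₀,α₁) < ∞ and t(u₀,α₂)·|u'(t(u₀,α₂),α₂)| > t(u₀,α₁)·|u'(t(u₀,α₁),α₁)|, then: u(R(α₂),α₂)=0; for every s∈(0,u₀) one has t(s,α₂) < t(s,α₁) and t(s,α₂)·|u'(t(s,α₂),α₂)| > t(s,α₁)·|u'(t(s,α₁),α₁)|; and R(α₂) < R(α₁) with lim_{r→R(α₂)} r·|u'(r,α₂)| > lim_{r→R(α₁)} r·|u'(r,α₁)| (in particular R(α₂)<∞ and α₂ ∈ N). -/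
open Set Filter Topology MeasureTheory
open scoped ENNReal NNReal

noncomputable section

/-- If the profile `W₂` dominates `W₁`, the ratio of the inverse functions `t₂ / t₁` is strictly
increasing and the gap `W₂ - W₁` is decreasing. -/
theorem antitoneOn_sub_and_strictMonoOn_div_of_lt {a b c e : ℝ} {t₁ t₂ W₁ W₂ g h : ℝ → ℝ}
    (he : 0 ≤ e)
    (ht₁ : ∀ s ∈ Icc a b, 0 < t₁ s) (ht₂ : ∀ s ∈ Icc a b, 0 < t₂ s)
    (hW₁ : ∀ s ∈ Icc a b, 0 < W₁ s)
    (dt₁ : ∀ s ∈ Icc a b, HasDerivAt t₁ (-(t₁ s) / W₁ s) s)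
    (dt₂ : ∀ s ∈ Icc a b, HasDerivAt t₂ (-(t₂ s) / W₂ s) s)
    (dW₁ : ∀ s ∈ Icc a b, HasDerivAt W₁ (c + g (t₁ s) * h s * W₁ s ^ (-e)) s)
    (dW₂ : ∀ s ∈ Icc a b, HasDerivAt W₂ (c + g (t₂ s) * h s * W₂ s ^ (-e)) s)
    (hh : ∀ s ∈ Ioo a b, 0 ≤ h s) (hg : MonotoneOn g (Ioi 0)) (hg0 : ∀ r, 0 < r → 0 ≤ g r)
    (htb : t₂ b ≤ t₁ b) (hlt : ∀ s ∈ Ioc a b, W₁ s < W₂ s) :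
    AntitoneOn (fun s => W₂ s - W₁ s) (Icc a b) ∧ StrictMonoOn (fun s => t₂ s / t₁ s) (Icc a b) := by
  have dr : ∀ s ∈ Icc a b, HasDerivAt (fun s => t₂ s / t₁ s)
      ((-(t₂ s) / W₂ s * t₁ s - t₂ s * (-(t₁ s) / W₁ s)) / t₁ s ^ 2) s := fun s hs =>
    (dt₂ s hs).fun_div (dt₁ s hs) (ht₁ s hs).ne'
  have hr : StrictMonoOn (fun s => t₂ s / t₁ s) (Icc a b) := by
    apply strictMonoOn_of_deriv_pos (convex_Icc a b)
    · exact fun s hs => (dr s hs).continuousAt.continuousWithinAt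
    · intro s hs
      rw [interior_Icc] at hs
      have hs' := Ioo_subset_Icc_self hs
      rw [(dr s hs').deriv]
      have h1 := ht₁ s hs'
      have h2 := ht₂ s hs'
      have h3 := hW₁ s hs'
      have h4 := hlt s (Ioo_subset_Ioc_self hs)
      have h5 : (W₂ s)⁻¹ < (W₁ s)⁻¹ := inv_strictAnti₀ h3 h4
      have : -(t₂ s) / W₂ s * t₁ s - t₂ s * (-(t₁ s) / W₁ s)
          = t₂ s * t₁ s * ((W₁ s)⁻¹ - (W₂ s)⁻¹) := by ring
      rw [this]
      have := sub_pos.2 h5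
      positivity
  refine ⟨?_, hr⟩
  have dd : ∀ s ∈ Icc a b, HasDerivAt (fun s => W₂ s - W₁ s)
      (c + g (t₂ s) * h s * W₂ s ^ (-e) - (c + g (t₁ s) * h s * W₁ s ^ (-e))) s :=
    fun s hs => (dW₂ s hs).fun_sub (dW₁ s hs)
  apply antitoneOn_of_deriv_nonpos (convex_Icc a b)
  · exact fun s hs => (dd s hs).continuousAt.continuousWithinAt
  · exact fun s hs => (dd s (interior_subset hs)).differentiableAt.differentiableWithinAt
  · intro s hs
    rw [interior_Icc] at hs
    have hs' := Ioo_subset_Icc_self hs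
    rw [(dd s hs').deriv]
    have h1 := ht₁ s hs'
    have h2 := ht₂ s hs'
    have h3 := hW₁ s hs'
    have h4 := hlt s (Ioo_subset_Ioc_self hs)
    have hb : b ∈ Icc a b := ⟨(hs.1.trans hs.2).le, le_rfl⟩
    have h6 : t₂ s ≤ t₁ s := by
      have h7 := (hr hs' hb hs.2).trans_le ((div_le_one (ht₁ b hb)).2 htb)
      exact ((div_lt_one h1).1 h7).le
    have h8 : g (t₂ s) * h s ≤ g (t₁ s) * h s :=
      mul_le_mul_of_nonneg_right (hg h2 h1 h6) (hh s hs)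
    have h9 : W₂ s ^ (-e) ≤ W₁ s ^ (-e) :=
      Real.rpow_le_rpow_of_nonpos h3 h4.le (neg_nonpos.2 he)
    have h10 := mul_le_mul h8 h9 (Real.rpow_nonneg (h3.trans h4).le _)
      (mul_nonneg (hg0 _ h1) (hh s hs))
    linarith

/-- The ordering `t₂ ≤ t₁`, `W₁ < W₂` at the right endpoint propagates to the left. -/
theorem antitoneOn_sub_and_strictMonoOn_div {a b c e : ℝ} {t₁ t₂ W₁ W₂ g h : ℝ → ℝ}
    (he : 0 ≤ e)
    (ht₁ : ∀ s ∈ Icc a b, 0 < t₁ s) (ht₂ : ∀ s ∈ Icc a b, 0 < t₂ s)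
    (hW₁ : ∀ s ∈ Icc a b, 0 < W₁ s)
    (dt₁ : ∀ s ∈ Icc a b, HasDerivAt t₁ (-(t₁ s) / W₁ s) s)
    (dt₂ : ∀ s ∈ Icc a b, HasDerivAt t₂ (-(t₂ s) / W₂ s) s)
    (dW₁ : ∀ s ∈ Icc a b, HasDerivAt W₁ (c + g (t₁ s) * h s * W₁ s ^ (-e)) s)
    (dW₂ : ∀ s ∈ Icc a b, HasDerivAt W₂ (c + g (t₂ s) * h s * W₂ s ^ (-e)) s)
    (hh : ∀ s ∈ Ioo a b, 0 ≤ h s) (hg : MonotoneOn g (Ioi 0)) (hg0 : ∀ r, 0 < r → 0 ≤ g r)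
    (htb : t₂ b ≤ t₁ b) (hWb : W₁ b < W₂ b) :
    AntitoneOn (fun s => W₂ s - W₁ s) (Icc a b) ∧ StrictMonoOn (fun s => t₂ s / t₁ s) (Icc a b) := by
  refine antitoneOn_sub_and_strictMonoOn_div_of_lt he ht₁ ht₂ hW₁ dt₁ dt₂ dW₁ dW₂ hh hg hg0 htb ?_
  by_contra! hcon
  obtain ⟨s₀, hs₀, hs₀W⟩ := hcon
  set S : Set ℝ := Icc a b ∩ (fun s => W₂ s - W₁ s) ⁻¹' Iic 0 with hS
  have hcont : ContinuousOn (fun s => W₂ s - W₁ s) (Icc a b) := fun s hs =>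
    ((dW₂ s hs).fun_sub (dW₁ s hs)).continuousAt.continuousWithinAt
  have hScl : IsClosed S := hcont.preimage_isClosed_of_isClosed isClosed_Icc isClosed_Iic
  have hSne : S.Nonempty := ⟨s₀, Ioc_subset_Icc_self hs₀, by simpa using hs₀W⟩
  have hSbd : BddAbove S := ⟨b, fun s hs => hs.1.2⟩
  have hm : sSup S ∈ S := hScl.csSup_mem hSne hSbd
  set m := sSup S with hm_def
  have hsub : Icc m b ⊆ Icc a b := Icc_subset_Icc_left hm.1.1
  have key := (antitoneOn_sub_and_strictMonoOn_div_of_lt (a := m) he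
    (fun s hs => ht₁ s (hsub hs)) (fun s hs => ht₂ s (hsub hs)) (fun s hs => hW₁ s (hsub hs))
    (fun s hs => dt₁ s (hsub hs)) (fun s hs => dt₂ s (hsub hs)) (fun s hs => dW₁ s (hsub hs))
    (fun s hs => dW₂ s (hsub hs)) (fun s hs => hh s ⟨hm.1.1.trans_lt hs.1, hs.2⟩) hg hg0 htb
    (by
      intro s hs
      by_contra! hle
      exact absurd (le_csSup hSbd (show s ∈ S from
        ⟨hsub (Ioc_subset_Icc_self hs), by simpa using hle⟩)) (not_le.2 hs.1))).1
  have h1 := key ⟨le_rfl, hm.1.2⟩ ⟨hm.1.2, le_rfl⟩ hm.1.2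
  have h2 : W₂ m - W₁ m ≤ 0 := hm.2
  simp only at h1
  linarith

/-- Condition (K1) makes `r ↦ r ^ p * K r` increasing. -/
theorem CondK1.monotoneOn_rpow_mul {p : ℝ} {K : ℝ → ℝ} (hK : CondK1 p K) :
    MonotoneOn (fun r => r ^ p * K r) (Ioi 0) := by
  obtain ⟨hpos, hC, hlog, -⟩ := hK
  have hd : ∀ r ∈ Ioi (0:ℝ), HasDerivAt (fun r => r ^ p * K r)
      (p * r ^ (p - 1) * K r + r ^ p * deriv K r) r := by
    intro r hr
    have h1 : DifferentiableAt ℝ K r :=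
      (hC.differentiableOn one_ne_zero).differentiableAt (Ioi_mem_nhds hr)
    exact (Real.hasDerivAt_rpow_const (Or.inl (ne_of_gt hr))).mul h1.hasDerivAt
  apply monotoneOn_of_deriv_nonneg (convex_Ioi 0)
  · exact fun r hr => (hd r hr).continuousAt.continuousWithinAt
  · exact fun r hr => (hd r (interior_subset hr)).differentiableAt.differentiableWithinAt
  · intro r hr
    have hr := interior_subset hr
    rw [(hd r hr).deriv]
    have hr0 : 0 < r := hr
    have h1 := hpos r hr
    have h2 := hlog r hr
    have h3 : p * r ^ (p - 1) * K r + r ^ p * deriv K r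
        = r ^ (p - 1) * K r * (p + r * deriv K r / K r) := by
      rw [Real.rpow_sub_one hr0.ne']
      field_simp
    rw [h3]
    positivity

theorem pos_and_uderiv_neg_of_lt_Rend {v : ℝ → ℝ} {r : ℝ} (h0 : 0 < r)
    (hr : ENNReal.ofReal r < Rend v) : 0 < v r ∧ uderiv v r < 0 := by
  obtain ⟨R, hR, hlt⟩ := lt_sSup_iff.1 hr
  exact hR r h0 hlt

namespace IsRadialSolution

variable {p : ℝ} {n : ℕ} {K f v : ℝ → ℝ}

theorem contDiffAt (hv : IsRadialSolution p n K f (Ici 0) v) {r : ℝ} (hr : 0 < r) :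
    ContDiffAt ℝ 1 v r :=
  hv.2.2.1.contDiffAt (Ici_mem_nhds hr)

theorem hasStrictDerivAt (hv : IsRadialSolution p n K f (Ici 0) v) {r : ℝ} (hr : 0 < r) :
    HasStrictDerivAt v (uderiv v r) r := by
  rw [uderiv, derivWithin_of_mem_nhds (Ici_mem_nhds hr)]
  exact (hv.contDiffAt hr).hasStrictDerivAt one_ne_zero

theorem continuousOn_uderiv (hv : IsRadialSolution p n K f (Ici 0) v) :
    ContinuousOn (uderiv v) (Ici 0) :=
  hv.2.2.1.continuousOn_derivWithin (uniqueDiffOn_Ici 0) le_rfl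

theorem continuousAt_uderiv (hv : IsRadialSolution p n K f (Ici 0) v) {r : ℝ} (hr : 0 < r) :
    ContinuousAt (uderiv v) r :=
  hv.continuousOn_uderiv.continuousAt (Ici_mem_nhds hr)

theorem strictAntiOn (hv : IsRadialSolution p n K f (Ici 0) v) {b : ℝ}
    (hb : ENNReal.ofReal b < Rend v) : StrictAntiOn v (Icc 0 b) := by
  apply strictAntiOn_of_deriv_neg (convex_Icc 0 b) (hv.2.2.1.continuousOn.mono Icc_subset_Ici_self)
  intro r hr
  rw [interior_Icc] at hr
  rw [(hv.hasStrictDerivAt hr.1).hasDerivAt.deriv]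
  exact (pos_and_uderiv_neg_of_lt_Rend hr.1
    ((ENNReal.ofReal_le_ofReal hr.2.le).trans_lt hb)).2

theorem tInv_apply (hv : IsRadialSolution p n K f (Ici 0) v) {r : ℝ} (h0 : 0 ≤ r)
    (hr : ENNReal.ofReal r < Rend v) : tInv v (v r) = r := by
  refine IsLeast.csInf_eq ⟨⟨h0, rfl⟩, fun x hx => ?_⟩
  by_contra! hlt
  exact absurd hx.2 (hv.strictAntiOn hr ⟨hx.1, hlt.le⟩ ⟨h0, le_rfl⟩ hlt).ne'

theorem hasDerivAt_tInv (hv : IsRadialSolution p n K f (Ici 0) v) {r : ℝ} (h0 : 0 < r)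
    (hr : ENNReal.ofReal r < Rend v) : HasDerivAt (tInv v) (uderiv v r)⁻¹ (v r) := by
  have hd := hv.hasStrictDerivAt h0
  have hne := (pos_and_uderiv_neg_of_lt_Rend h0 hr).2.ne
  have hloc := (hd.to_localInverse hne).hasDerivAt
  refine hloc.congr_of_eventuallyEq ?_
  have hev : ∀ᶠ x in 𝓝 r, 0 < x ∧ ENNReal.ofReal x < Rend v :=
    (eventually_gt_nhds h0).and
      (ENNReal.continuous_ofReal.continuousAt.eventually_lt continuousAt_const hr)
  have hf' := hd.hasStrictFDerivAt_equiv hne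
  have htend := hf'.localInverse_tendsto
  filter_upwards [hf'.eventually_right_inverse, htend.eventually hev] with y hy1 hy2
  calc tInv v y = tInv v (v (hf'.localInverse v _ r y)) := by rw [hy1]
    _ = _ := hv.tInv_apply hy2.1.le hy2.2

theorem hasDerivAt_mul_abs_uderiv (hv : IsRadialSolution p n K f (Ici 0) v) (hp : 1 < p) {r : ℝ}
    (h0 : 0 < r) (hr : ENNReal.ofReal r < Rend v) (hn : 1 ≤ n) :
    HasDerivAt (fun x => x * |uderiv v x|)
      (-(|uderiv v r| * (((n : ℝ) - p) / (p - 1) +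
        r ^ p * K r * (-f (v r) / (p - 1)) * (r * |uderiv v r|) ^ (-(p - 1))))) r := by
  have hp1 : 0 < p - 1 := sub_pos.2 hp
  have hneg := (pos_and_uderiv_neg_of_lt_Rend h0 hr).2
  have hev : ∀ᶠ x in 𝓝 r, 0 < x ∧ uderiv v x < 0 :=
    (eventually_gt_nhds h0).and
      ((hv.continuousAt_uderiv h0).eventually_lt continuousAt_const hneg)
  have hQ : HasDerivAt (fun x => x ^ (n - 1) * phiP p (uderiv v x))
      (-(r ^ (n - 1) * K r * f (v r))) r :=
    (hv.2.2.2.2 r h0.le h0).hasDerivAt (Ici_mem_nhds h0)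
  set q := |uderiv v r| with hq
  have hq0 : 0 < q := abs_pos.2 hneg.ne
  have hphi : ∀ x, uderiv v x < 0 → phiP p (uderiv v x) = -|uderiv v x| ^ (p - 1) := by
    intro x hx
    have : 0 < |uderiv v x| := abs_pos.2 hx.ne
    rw [phiP, show p - 1 = p - 2 + 1 by ring, Real.rpow_add_one this.ne']
    nth_rewrite 2 [← neg_neg (uderiv v x)]
    rw [← abs_of_neg hx]
    ring
  have hpow : HasDerivAt (fun x : ℝ => x ^ (n - 1)) (((n : ℝ) - 1) / r * r ^ (n - 1)) r := by
    refine (hasDerivAt_pow (n - 1) r).congr_deriv ?_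
    rw [← Nat.cast_pred hn]
    rcases n - 1 with _ | m
    · simp
    · simp only [Nat.add_sub_cancel]
      field_simp
      ring
  have hrn : 0 < r ^ (n - 1) := pow_pos h0 _
  have hY := (hQ.neg.div hpow hrn.ne').rpow_const (p := (p - 1)⁻¹)
    (Or.inl (by
      simp only [Pi.neg_apply, hphi r hneg, Pi.div_apply]
      have : 0 < q ^ (p - 1) := Real.rpow_pos_of_pos hq0 _
      have : -(r ^ (n - 1) * -q ^ (p - 1)) / r ^ (n - 1) = q ^ (p - 1) := by field_simp
      rw [this]; positivity))
  have hw := (hasDerivAt_id r).mul hY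
  have heq : ∀ x, 0 < x → uderiv v x < 0 →
      -(x ^ (n - 1) * phiP p (uderiv v x)) / x ^ (n - 1) = |uderiv v x| ^ (p - 1) := by
    intro x hx1 hx2
    rw [hphi x hx2]
    have := (pow_pos hx1 (n - 1)).ne'
    field_simp
  have hinv : ∀ y : ℝ, 0 ≤ y → (y ^ (p - 1)) ^ (p - 1)⁻¹ = y := fun y hy =>
    Real.rpow_rpow_inv hy hp1.ne'
  refine (hw.congr_of_eventuallyEq ?_).congr_deriv ?_
  · filter_upwards [hev] with x hx
    simp only [Pi.mul_apply, id, Pi.div_apply, Pi.neg_apply]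
    rw [heq x hx.1 hx.2, hinv _ (abs_nonneg _)]
  · simp only [id, Pi.div_apply, Pi.neg_apply]
    rw [heq r h0 hneg, hinv _ (abs_nonneg _), hphi r hneg, ← hq,
      Real.rpow_sub_one (by positivity : q ^ (p - 1) ≠ 0), hinv _ hq0.le,
      Real.mul_rpow h0.le hq0.le, Real.rpow_neg h0.le, Real.rpow_neg hq0.le,
      show r ^ p = r ^ (p - 1) * r by rw [← Real.rpow_add_one h0.ne']; ring_nf]
    have h1 : 0 < r ^ (p - 1) := Real.rpow_pos_of_pos h0 _
    have h2 : 0 < q ^ (p - 1) := Real.rpow_pos_of_pos hq0 _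
    field_simp
    ring

/-- The differential equations satisfied by `tInv v` and `s ↦ t |u' t|`, `t = tInv v s`, at an
attained value `s`. -/
theorem hasDerivAt_profile (hv : IsRadialSolution p n K f (Ici 0) v) (hp : 1 < p) (hn : 1 ≤ n)
    {s : ℝ} (hs : ∃ r, 0 < r ∧ ENNReal.ofReal r < Rend v ∧ v r = s) :
    0 < tInv v s ∧ 0 < tInv v s * |uderiv v (tInv v s)| ∧
    HasDerivAt (tInv v) (-(tInv v s) / (tInv v s * |uderiv v (tInv v s)|)) s ∧
    HasDerivAt (fun s => tInv v s * |uderiv v (tInv v s)|)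
      (((n : ℝ) - p) / (p - 1) +
        (tInv v s ^ p * K (tInv v s)) * (-f s / (p - 1)) *
          (tInv v s * |uderiv v (tInv v s)|) ^ (-(p - 1))) s := by
  obtain ⟨r, h0, hr, rfl⟩ := hs
  have hneg := (pos_and_uderiv_neg_of_lt_Rend h0 hr).2
  have hq0 : 0 < |uderiv v r| := abs_pos.2 hneg.ne
  have ht := hv.tInv_apply h0.le hr
  have hdt := hv.hasDerivAt_tInv h0 hr
  have hdw := hv.hasDerivAt_mul_abs_uderiv hp h0 hr hn
  have hinv : (uderiv v r)⁻¹ = -(1 / |uderiv v r|) := by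
    rw [abs_of_neg hneg, one_div, inv_neg, neg_neg]
  rw [← ht] at hdw
  have hcomp := hdw.comp (v r) hdt
  rw [ht] at hcomp ⊢
  refine ⟨h0, by positivity, hdt.congr_deriv ?_, hcomp.congr_deriv ?_⟩
  · rw [hinv]; field_simp
  · rw [hinv]; field_simp

end IsRadialSolution

theorem endFilter_neBot (R : ℝ≥0∞) : (endFilter R).NeBot := by
  unfold endFilter
  split_ifs <;> infer_instance

theorem eventually_endFilter {R : ℝ≥0∞} {a : ℝ} (ha : ENNReal.ofReal a < R) (ha0 : 0 ≤ a) :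
    ∀ᶠ x in endFilter R, a < x ∧ ENNReal.ofReal x < R := by
  unfold endFilter
  split_ifs with h
  · filter_upwards [eventually_gt_atTop a] with x hx
    exact ⟨hx, h ▸ ENNReal.ofReal_lt_top⟩
  · have ha' : a < R.toReal := (ENNReal.ofReal_lt_iff_lt_toReal ha0 h).1 ha
    filter_upwards [Ioo_mem_nhdsLT ha'] with x hx
    exact ⟨hx.1, (ENNReal.ofReal_lt_iff_lt_toReal (ha0.trans hx.1.le) h).2 hx.2⟩

namespace IsRadialSolution

variable {p : ℝ} {n : ℕ} {K f v : ℝ → ℝ}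

theorem exists_eq (hv : IsRadialSolution p n K f (Ici 0) v) {a b s : ℝ} (ha : 0 ≤ a)
    (hab : a ≤ b) (hs : s ∈ Icc (v b) (v a)) : ∃ r ∈ Icc a b, v r = s :=
  intermediate_value_Icc' hab
    (hv.2.2.1.continuousOn.mono (Icc_subset_Ici_self.trans (Ici_subset_Ici.2 ha))) hs

theorem exists_eq_of_tendsto_zero (hv : IsRadialSolution p n K f (Ici 0) v) {a s : ℝ}
    (ha : 0 ≤ a) (haR : ENNReal.ofReal a < Rend v)
    (hlim : Tendsto v (endFilter (Rend v)) (𝓝 0)) (hs : s ∈ Ioc 0 (v a)) :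
    ∃ r, a ≤ r ∧ ENNReal.ofReal r < Rend v ∧ v r = s := by
  have := endFilter_neBot (Rend v)
  obtain ⟨x, hx, hax, hxR⟩ :=
    ((hlim.eventually_lt_const hs.1).and (eventually_endFilter haR ha)).exists
  obtain ⟨r, hr, rfl⟩ := hv.exists_eq ha hax.le ⟨hx.le, hs.2⟩
  exact ⟨r, hr.1, (ENNReal.ofReal_le_ofReal hr.2).trans_lt hxR, rfl⟩

theorem antitoneOn_mul_abs_uderiv (hv : IsRadialSolution p n K f (Ici 0) v) (hp : 1 < p)
    (hn : p < n) (hK : ∀ r, 0 < r → 0 < K r) {u₀ : ℝ} (hf : ∀ y ∈ Ioo 0 u₀, f y ≤ 0)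
    {a : ℝ} (ha : 0 < a) (hva : v a ≤ u₀) :
    AntitoneOn (fun r => r * |uderiv v r|) {r | a ≤ r ∧ ENNReal.ofReal r < Rend v} := by
  have hn1 : 1 ≤ n := by exact_mod_cast (hp.trans hn).le
  have hp1 : 0 < p - 1 := sub_pos.2 hp
  intro x hx y hy hxy
  have hlt : ∀ r ∈ Icc a y, ENNReal.ofReal r < Rend v := fun r hr =>
    (ENNReal.ofReal_le_ofReal hr.2).trans_lt hy.2
  have hd := fun r (hr : r ∈ Icc a y) =>
    hv.hasDerivAt_mul_abs_uderiv hp (ha.trans_le hr.1) (hlt r hr) hn1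
  refine antitoneOn_of_deriv_nonpos (convex_Icc a y)
    (fun r hr => (hd r hr).continuousAt.continuousWithinAt)
    (fun r hr => (hd r (interior_subset hr)).differentiableAt.differentiableWithinAt)
    (fun r hr => ?_) ⟨hx.1, hxy⟩ ⟨hy.1, le_rfl⟩ hxy
  have hr' := interior_subset hr
  rw [interior_Icc] at hr
  rw [(hd r hr').deriv]
  have hr0 : 0 < r := ha.trans hr.1
  have hvr : v r < v a := hv.strictAntiOn (hlt r hr') ⟨ha.le, hr.1.le⟩ ⟨hr0.le, le_rfl⟩ hr.1
  have hfr := hf (v r) ⟨(pos_and_uderiv_neg_of_lt_Rend hr0 (hlt r hr')).1, hvr.trans_le hva⟩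
  have h1 : 0 ≤ -f (v r) / (p - 1) := div_nonneg (neg_nonneg.2 hfr) hp1.le
  have h2 : 0 ≤ ((n : ℝ) - p) / (p - 1) := div_nonneg (sub_pos.2 hn).le hp1.le
  have h3 := hK r hr0
  rw [neg_nonpos]
  positivity

/-- The quantity `r * |u' r|` has a limit at the endpoint and is bounded below by it. -/
theorem exists_tendsto_mul_abs_uderiv (hv : IsRadialSolution p n K f (Ici 0) v) (hp : 1 < p)
    (hn : p < n) (hK : ∀ r, 0 < r → 0 < K r) {u₀ : ℝ} (hf : ∀ y ∈ Ioo 0 u₀, f y ≤ 0)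
    {a : ℝ} (ha : 0 < a) (haR : ENNReal.ofReal a < Rend v) (hva : v a ≤ u₀) :
    ∃ L, Tendsto (fun r => r * |uderiv v r|) (endFilter (Rend v)) (𝓝 L) ∧
      ∀ r, a ≤ r → ENNReal.ofReal r < Rend v → L ≤ r * |uderiv v r| := by
  have hanti := hv.antitoneOn_mul_abs_uderiv hp hn hK hf ha hva
  have hex : ∃ L, Tendsto (fun r => r * |uderiv v r|) (endFilter (Rend v)) (𝓝 L) := by
    unfold endFilter
    split_ifs with h
    · have hm : ∀ x, max x a ∈ {r | a ≤ r ∧ ENNReal.ofReal r < Rend v} := fun x =>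
        ⟨le_max_right _ _, h ▸ ENNReal.ofReal_lt_top⟩
      have hA : Antitone (fun x => max x a * |uderiv v (max x a)|) := fun x y hxy =>
        hanti (hm x) (hm y) (max_le_max_right a hxy)
      refine ⟨_, (tendsto_atTop_ciInf hA ⟨0, ?_⟩).congr' ?_⟩
      · rintro _ ⟨x, rfl⟩
        have : 0 < max x a := ha.trans_le (le_max_right _ _)
        positivity
      · filter_upwards [eventually_ge_atTop a] with x hx
        rw [max_eq_left hx]
    · have hR : 0 < (Rend v).toReal := ha.trans ((ENNReal.ofReal_lt_iff_lt_toReal ha.le h).1 haR)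
      exact ⟨_, ((continuousAt_id.mul (hv.continuousAt_uderiv hR).abs).tendsto).mono_left
        nhdsWithin_le_nhds⟩
  obtain ⟨L, hL⟩ := hex
  refine ⟨L, hL, fun r har hrR => ?_⟩
  have := endFilter_neBot (Rend v)
  refine le_of_tendsto hL ?_
  filter_upwards [eventually_endFilter hrR (ha.le.trans har)] with x hx
  exact hanti ⟨har, hrR⟩ ⟨har.trans hx.1.le, hx.2⟩ hx.1.le

theorem Rend_ne_top_of_le (hv : IsRadialSolution p n K f (Ici 0) v) {a c : ℝ} (ha : 0 < a)
    (hc : 0 < c) (h : ∀ r, a ≤ r → ENNReal.ofReal r < Rend v → c ≤ r * |uderiv v r|) :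
    Rend v ≠ ⊤ := by
  intro htop
  have hlt : ∀ r, ENNReal.ofReal r < Rend v := fun r => htop ▸ ENNReal.ofReal_lt_top
  have hd : ∀ r ∈ Ici a, HasDerivAt (fun r => v r + c * Real.log r) (uderiv v r + c * r⁻¹) r :=
    fun r hr => (hv.hasStrictDerivAt (ha.trans_le hr)).hasDerivAt.add
      ((Real.hasDerivAt_log (ha.trans_le hr).ne').const_mul c)
  have hanti : AntitoneOn (fun r => v r + c * Real.log r) (Ici a) := by
    refine antitoneOn_of_deriv_nonpos (convex_Ici a)
      (fun r hr => (hd r hr).continuousAt.continuousWithinAt)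
      (fun r hr => (hd r (interior_subset hr)).differentiableAt.differentiableWithinAt)
      (fun r hr => ?_)
    have hr' := interior_subset hr
    have hr0 : 0 < r := ha.trans_le hr'
    rw [(hd r hr').deriv]
    have h1 := h r hr' (hlt r)
    rw [abs_of_neg (pos_and_uderiv_neg_of_lt_Rend hr0 (hlt r)).2, ← div_le_iff₀' hr0] at h1
    rw [← div_eq_mul_inv]
    linarith
  have hlog : Tendsto (fun r => c * Real.log r) atTop atTop :=
    Real.tendsto_log_atTop.const_mul_atTop hc
  obtain ⟨r, hr1, hr2⟩ :=
    ((hlog.eventually_gt_atTop (v a + c * Real.log a)).and (eventually_ge_atTop a)).exists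
  have h2 := hanti self_mem_Ici hr2 hr2
  have h3 := (pos_and_uderiv_neg_of_lt_Rend (ha.trans_le hr2) (hlt r)).1
  simp only at h2
  linarith

theorem apply_Rend_eq_zero (hv : IsRadialSolution p n K f (Ici 0) v) (htop : Rend v ≠ ⊤)
    (h0 : 0 < (Rend v).toReal) (hd : uderiv v (Rend v).toReal < 0) : v (Rend v).toReal = 0 := by
  set ρ := (Rend v).toReal with hρ
  have hcont : ContinuousAt v ρ := (hv.hasStrictDerivAt h0).hasDerivAt.continuousAt
  have hnn : 0 ≤ v ρ := by
    refine ge_of_tendsto (hcont.tendsto.mono_left (nhdsWithin_le_nhds (s := Iio ρ))) ?_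
    filter_upwards [Ioo_mem_nhdsLT h0] with x hx
    exact (pos_and_uderiv_neg_of_lt_Rend hx.1
      ((ENNReal.ofReal_lt_iff_lt_toReal hx.1.le htop).2 hx.2)).1.le
  by_contra hne
  have hpos : 0 < v ρ := lt_of_le_of_ne hnn (Ne.symm hne)
  obtain ⟨ε, hε, hball⟩ := Metric.eventually_nhds_iff.1
    ((continuousAt_const.eventually_lt hcont hpos).and
      ((hv.continuousAt_uderiv h0).eventually_lt continuousAt_const hd))
  have hle : ENNReal.ofReal (ρ + ε) ≤ Rend v := by
    refine le_sSup fun t ht htR => ?_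
    rcases lt_or_ge t ρ with h | h
    · exact pos_and_uderiv_neg_of_lt_Rend ht ((ENNReal.ofReal_lt_iff_lt_toReal ht.le htop).2 h)
    · apply hball
      have := (ENNReal.ofReal_lt_ofReal_iff (by positivity)).1 htR
      rw [Real.dist_eq, abs_of_nonneg (sub_nonneg.2 h)]
      linarith
  rw [ENNReal.ofReal_le_iff_le_toReal htop] at hle
  linarith

/-- Comparison of two solutions on a range of values below `u₀` attained by both. -/
theorem comparison {v₁ v₂ : ℝ → ℝ} (hv₁ : IsRadialSolution p n K f (Ici 0) v₁)
    (hv₂ : IsRadialSolution p n K f (Ici 0) v₂) (hp : 1 < p) (hn : p < n) (hK : CondK1 p K)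
    {u₀ : ℝ} (hf : ∀ y ∈ Ioo 0 u₀, f y ≤ 0) {r₁ r₂ x₁ x₂ : ℝ} (hr₁ : 0 < r₁) (hr₂ : 0 < r₂)
    (hu₁ : v₁ r₁ = u₀) (hu₂ : v₂ r₂ = u₀) (hx₁ : r₁ ≤ x₁) (hx₂ : r₂ ≤ x₂)
    (hR₁ : ENNReal.ofReal x₁ < Rend v₁) (hR₂ : ENNReal.ofReal x₂ < Rend v₂)
    (hx : v₁ x₁ = v₂ x₂) (hle : r₂ ≤ r₁) (hgt : r₁ * |uderiv v₁ r₁| < r₂ * |uderiv v₂ r₂|) :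
    AntitoneOn (fun s => tInv v₂ s * |uderiv v₂ (tInv v₂ s)| -
      tInv v₁ s * |uderiv v₁ (tInv v₁ s)|) (Icc (v₂ x₂) u₀) ∧
    StrictMonoOn (fun s => tInv v₂ s / tInv v₁ s) (Icc (v₂ x₂) u₀) := by
  have hn1 : 1 ≤ n := by exact_mod_cast (hp.trans hn).le
  have hp1 : 0 < p - 1 := sub_pos.2 hp
  have P₁ : ∀ s ∈ Icc (v₂ x₂) u₀, ∃ r, 0 < r ∧ ENNReal.ofReal r < Rend v₁ ∧ v₁ r = s := by
    intro s hs
    obtain ⟨r, hr, hrs⟩ := hv₁.exists_eq hr₁.le hx₁ (s := s) (by rwa [hx, hu₁])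
    exact ⟨r, hr₁.trans_le hr.1, (ENNReal.ofReal_le_ofReal hr.2).trans_lt hR₁, hrs⟩
  have P₂ : ∀ s ∈ Icc (v₂ x₂) u₀, ∃ r, 0 < r ∧ ENNReal.ofReal r < Rend v₂ ∧ v₂ r = s := by
    intro s hs
    obtain ⟨r, hr, hrs⟩ := hv₂.exists_eq hr₂.le hx₂ (s := s) (by rwa [hu₂])
    exact ⟨r, hr₂.trans_le hr.1, (ENNReal.ofReal_le_ofReal hr.2).trans_lt hR₂, hrs⟩
  have hpos : 0 < v₂ x₂ := (pos_and_uderiv_neg_of_lt_Rend (hr₂.trans_le hx₂) hR₂).1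
  have ht₁ : tInv v₁ u₀ = r₁ := by
    rw [← hu₁]
    exact hv₁.tInv_apply hr₁.le ((ENNReal.ofReal_le_ofReal hx₁).trans_lt hR₁)
  have ht₂ : tInv v₂ u₀ = r₂ := by
    rw [← hu₂]
    exact hv₂.tInv_apply hr₂.le ((ENNReal.ofReal_le_ofReal hx₂).trans_lt hR₂)
  have Q₁ := fun s hs => hv₁.hasDerivAt_profile hp hn1 (P₁ s hs)
  have Q₂ := fun s hs => hv₂.hasDerivAt_profile hp hn1 (P₂ s hs)
  exact antitoneOn_sub_and_strictMonoOn_div (a := v₂ x₂) (b := u₀)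
    (c := ((n : ℝ) - p) / (p - 1)) (e := p - 1)
    (W₁ := fun s => tInv v₁ s * |uderiv v₁ (tInv v₁ s)|)
    (W₂ := fun s => tInv v₂ s * |uderiv v₂ (tInv v₂ s)|)
    (g := fun r => r ^ p * K r) (h := fun s => -f s / (p - 1)) hp1.le
    (fun s hs => (Q₁ s hs).1) (fun s hs => (Q₂ s hs).1) (fun s hs => (Q₁ s hs).2.1)
    (fun s hs => (Q₁ s hs).2.2.1) (fun s hs => (Q₂ s hs).2.2.1)
    (fun s hs => (Q₁ s hs).2.2.2) (fun s hs => (Q₂ s hs).2.2.2)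
    (fun s hs => div_nonneg (neg_nonneg.2 (hf s ⟨hpos.trans hs.1, hs.2⟩)) hp1.le)
    hK.monotoneOn_rpow_mul
    (fun r hr => mul_nonneg (Real.rpow_nonneg hr.le p) (hK.1 r hr).le)
    (by rw [ht₁, ht₂]; exact hle)
    (by simp only [ht₁, ht₂]; exact hgt)

end IsRadialSolution

/-- Proposition 3.1, first part: comparison of solutions below `u₀`. -/
theorem comparison_below_u0_first
    (p : ℝ) (n : ℕ) (hp : 1 < p) (hn : p < n)
    (K f : ℝ → ℝ) (u₀ : ℝ) (hu₀ : 0 < u₀)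
    (hK : CondK1 p K) (hf1 : CondF1 f u₀) (hf2 : CondF2 f u₀)
    (u : ℝ → ℝ → ℝ) (hfam : IsFamily p n K f u₀ u)
    (uR : ℝ → ℝ)
    (huR : ∀ α : ℝ, u₀ < α → Tendsto (u α) (endFilter (Rend (u α))) (𝓝 (uR α)))
    (α₁ α₂ : ℝ) (hα₁ : α₁ ∈ Gset u uR u₀ ∪ Ncross u uR u₀) (hα₂ : u₀ < α₂)
    (hatt₁ : ∃ r : ℝ, 0 ≤ r ∧ ENNReal.ofReal r < Rend (u α₁) ∧ u α₁ r = u₀)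
    (hatt₂ : ∃ r : ℝ, 0 ≤ r ∧ ENNReal.ofReal r < Rend (u α₂) ∧ u α₂ r = u₀)
    (hle : tInv (u α₂) u₀ ≤ tInv (u α₁) u₀)
    (hgt : tInv (u α₁) u₀ * |uderiv (u α₁) (tInv (u α₁) u₀)| <
           tInv (u α₂) u₀ * |uderiv (u α₂) (tInv (u α₂) u₀)|) :
    uR α₂ = 0 ∧
    (∀ s ∈ Ioo (0:ℝ) u₀,
      tInv (u α₂) s < tInv (u α₁) s ∧
      tInv (u α₁) s * |uderiv (u α₁) (tInv (u α₁) s)| <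
        tInv (u α₂) s * |uderiv (u α₂) (tInv (u α₂) s)|) ∧
    Rend (u α₂) < Rend (u α₁) ∧
    (∃ L₁ L₂ : ℝ,
      Tendsto (fun r => r * |uderiv (u α₁) r|) (endFilter (Rend (u α₁))) (𝓝 L₁) ∧
      Tendsto (fun r => r * |uderiv (u α₂) r|) (endFilter (Rend (u α₂))) (𝓝 L₂) ∧
      L₁ < L₂) ∧
    Rend (u α₂) ≠ ⊤ ∧ α₂ ∈ Ncross u uR u₀ := by
  have hf := hf1.2.2.1
  obtain ⟨hv₁, hv₁0, -⟩ := hfam.1 α₁ (hα₁.elim (fun h => h.1) (fun h => h.1))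
  obtain ⟨hv₂, hv₂0, -⟩ := hfam.1 α₂ hα₂
  have hα₁u : u₀ < α₁ := hα₁.elim (fun h => h.1) (fun h => h.1)
  have hlim₁ : Tendsto (u α₁) (endFilter (Rend (u α₁))) (𝓝 0) := by
    have h0 : uR α₁ = 0 := hα₁.elim (fun h => h.2.1) (fun h => h.2.1)
    exact h0 ▸ huR α₁ hα₁u
  have hlim₂ := huR α₂ hα₂
  obtain ⟨r₁, hr₁, hR₁, hu₁⟩ := hatt₁
  obtain ⟨r₂, hr₂, hR₂, hu₂⟩ := hatt₂
  have ht₁ : tInv (u α₁) u₀ = r₁ := by rw [← hu₁]; exact hv₁.tInv_apply hr₁ hR₁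
  have ht₂ : tInv (u α₂) u₀ = r₂ := by rw [← hu₂]; exact hv₂.tInv_apply hr₂ hR₂
  have hr₁ : 0 < r₁ := by
    refine lt_of_le_of_ne hr₁ ?_
    rintro rfl
    exact hα₁u.ne (hu₁.symm.trans hv₁0)
  have hr₂ : 0 < r₂ := by
    refine lt_of_le_of_ne hr₂ ?_
    rintro rfl
    exact hα₂.ne (hu₂.symm.trans hv₂0)
  rw [ht₁, ht₂] at hle hgt
  generalize u α₁ = v₁ at *
  generalize hv₂_def : u α₂ = v₂ at *
  set c₀ := r₂ * |uderiv v₂ r₂| - r₁ * |uderiv v₁ r₁| with hc₀_def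
  have hc₀ : 0 < c₀ := sub_pos.2 hgt
  have hcmp : ∀ x, r₂ ≤ x → ENNReal.ofReal x < Rend v₂ →
      ∃ y, r₁ ≤ y ∧ ENNReal.ofReal y < Rend v₁ ∧ v₁ y = v₂ x ∧
        y * |uderiv v₁ y| + c₀ ≤ x * |uderiv v₂ x| ∧ x / y ≤ r₂ / r₁ ∧
        (r₂ < x → x / y < r₂ / r₁) ∧
        StrictMonoOn (fun s => tInv v₂ s / tInv v₁ s) (Icc (v₂ x) u₀) := by
    intro x hx hxR
    have hxu : v₂ x ≤ u₀ := by
      rw [← hu₂]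
      exact (hv₂.strictAntiOn hxR).antitoneOn ⟨hr₂.le, hx⟩ ⟨hr₂.le.trans hx, le_rfl⟩ hx
    have hxpos := (pos_and_uderiv_neg_of_lt_Rend (hr₂.trans_le hx) hxR).1
    obtain ⟨y, hy, hyR, hyx⟩ :=
      hv₁.exists_eq_of_tendsto_zero hr₁.le hR₁ hlim₁ ⟨hxpos, hxu.trans_eq hu₁.symm⟩
    obtain ⟨hA, hM⟩ := hv₁.comparison hv₂ hp hn hK hf hr₁ hr₂ hu₁ hu₂ hy hx hyR hxR hyx hle hgt
    have hty : tInv v₁ (v₂ x) = y := by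
      rw [← hyx]; exact hv₁.tInv_apply (hr₁.le.trans hy) hyR
    have htx : tInv v₂ (v₂ x) = x := hv₂.tInv_apply (hr₂.le.trans hx) hxR
    have hA' := hA (left_mem_Icc.2 hxu) (right_mem_Icc.2 hxu) hxu
    have hM' := hM.monotoneOn (left_mem_Icc.2 hxu) (right_mem_Icc.2 hxu) hxu
    simp only [hty, htx, ht₁, ht₂] at hA' hM'
    refine ⟨y, hy, hyR, hyx, by linarith, hM', fun hlt => ?_, hM⟩
    have hxu' : v₂ x < u₀ := by
      rw [← hu₂]
      exact hv₂.strictAntiOn hxR ⟨hr₂.le, hx⟩ ⟨hr₂.le.trans hx, le_rfl⟩ hlt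
    have := hM (left_mem_Icc.2 hxu) (right_mem_Icc.2 hxu) hxu'
    simpa only [hty, htx, ht₁, ht₂] using this
  have hgap : ∀ x, r₂ ≤ x → ENNReal.ofReal x < Rend v₂ → c₀ ≤ x * |uderiv v₂ x| := by
    intro x hx hxR
    obtain ⟨y, hy, -, -, h, -⟩ := hcmp x hx hxR
    have : 0 ≤ y * |uderiv v₁ y| := mul_nonneg (hr₁.le.trans hy) (abs_nonneg _)
    linarith
  have htop : Rend v₂ ≠ ⊤ := hv₂.Rend_ne_top_of_le hr₂ hc₀ hgap
  have hend : endFilter (Rend v₂) = 𝓝[<] (Rend v₂).toReal := if_neg htop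
  have hρ : r₂ < (Rend v₂).toReal := (ENNReal.ofReal_lt_iff_lt_toReal hr₂.le htop).1 hR₂
  set ρ := (Rend v₂).toReal with hρ_def
  have hρ0 : 0 < ρ := hr₂.trans hρ
  have hcd := hv₂.continuousAt_uderiv hρ0
  have hlimd : Tendsto (uderiv v₂) (endFilter (Rend v₂)) (𝓝 (uderiv v₂ ρ)) := by
    rw [hend]; exact hcd.tendsto.mono_left nhdsWithin_le_nhds
  have hlimw : Tendsto (fun r => r * |uderiv v₂ r|) (endFilter (Rend v₂))
      (𝓝 (ρ * |uderiv v₂ ρ|)) := by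
    rw [hend]; exact (continuousAt_id.mul hcd.abs).tendsto.mono_left nhdsWithin_le_nhds
  have hne := endFilter_neBot (Rend v₂)
  have hev := eventually_endFilter hR₂ hr₂.le
  have hdneg : uderiv v₂ ρ < 0 := by
    have h1 : uderiv v₂ ρ ≤ 0 := le_of_tendsto hlimd <| by
      filter_upwards [hev] with x hx
      exact (pos_and_uderiv_neg_of_lt_Rend (hr₂.trans hx.1) hx.2).2.le
    have h2 : c₀ ≤ ρ * |uderiv v₂ ρ| := ge_of_tendsto hlimw <| by
      filter_upwards [hev] with x hx
      exact hgap x hx.1.le hx.2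
    refine lt_of_le_of_ne h1 fun h => ?_
    rw [h, abs_zero, mul_zero] at h2
    linarith
  have huR₂ : uR α₂ = 0 := by
    have h1 : Tendsto v₂ (endFilter (Rend v₂)) (𝓝 (v₂ ρ)) := by
      rw [hend]
      exact (hv₂.hasStrictDerivAt hρ0).hasDerivAt.continuousAt.tendsto.mono_left
        nhdsWithin_le_nhds
    rw [tendsto_nhds_unique hlim₂ h1, hv₂.apply_Rend_eq_zero htop hρ0 hdneg]
  rw [huR₂] at hlim₂
  refine ⟨huR₂, fun s hs => ?_, ?_, ?_, htop, hα₂, huR₂, _, hdneg, by rw [hv₂_def]; exact hlimd⟩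
  · obtain ⟨x, hx, hxR, rfl⟩ := hv₂.exists_eq_of_tendsto_zero hr₂.le hR₂ hlim₂
      ⟨hs.1, hs.2.le.trans_eq hu₂.symm⟩
    obtain ⟨y, hy, hyR, hyx, h1, -, h2, -⟩ := hcmp x hx hxR
    have hx' : r₂ < x := lt_of_le_of_ne hx (by rintro rfl; exact hs.2.ne hu₂)
    have hy0 := hr₁.trans_le hy
    rw [hv₂.tInv_apply (hr₂.le.trans hx) hxR, ← hyx, hv₁.tInv_apply hy0.le hyR]
    refine ⟨?_, by linarith⟩
    exact (div_lt_one hy0).1 ((h2 hx').trans_le ((div_le_one hr₁).2 hle))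
  · by_cases htop₁ : Rend v₁ = ⊤
    · rw [htop₁]; exact lt_top_iff_ne_top.2 htop
    obtain ⟨x, hx⟩ := hev.exists
    obtain ⟨y, hy, hyR, hyx, -, -, hlt, -⟩ := hcmp x hx.1.le hx.2
    have hy0 := hr₁.trans_le hy
    have hk : x / y < 1 := (hlt hx.1).trans_le ((div_le_one hr₁).2 hle)
    have hk0 : 0 < x / y := div_pos (hr₂.trans hx.1) hy0
    have hρ₁ : 0 < (Rend v₁).toReal :=
      hr₁.trans ((ENNReal.ofReal_lt_iff_lt_toReal hr₁.le htop₁).1 hR₁)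
    have hbound : ρ ≤ x / y * (Rend v₁).toReal := by
      have htend : Tendsto (fun r : ℝ => r) (endFilter (Rend v₂)) (𝓝 ρ) := by
        rw [hend]; exact tendsto_id.mono_left nhdsWithin_le_nhds
      refine le_of_tendsto htend ?_
      filter_upwards [eventually_endFilter hx.2 (hr₂.trans hx.1).le] with z hz
      have hz2 := hx.1.trans hz.1
      obtain ⟨w, hw, hwR, hwz, -, -, -, hM⟩ := hcmp z hz2.le hz.2
      have hw0 := hr₁.trans_le hw
      have hanti := hv₂.strictAntiOn hz.2
      have hz0 : z ∈ Icc 0 z := ⟨(hr₂.trans hz2).le, le_rfl⟩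
      have hx0 : x ∈ Icc 0 z := ⟨(hr₂.trans hx.1).le, hz.1.le⟩
      have hzx : v₂ z ≤ v₂ x := (hanti hx0 hz0 hz.1).le
      have hxu : v₂ x ≤ u₀ := by
        rw [← hu₂]; exact (hanti ⟨hr₂.le, hz2.le⟩ hx0 hx.1).le
      have hm := hM.monotoneOn (left_mem_Icc.2 (hzx.trans hxu)) ⟨hzx, hxu⟩ hzx
      rw [hv₂.tInv_apply hz0.1 hz.2, hv₂.tInv_apply hx0.1 hx.2, ← hwz, ← hyx,
        hv₁.tInv_apply hw0.le hwR, hv₁.tInv_apply hy0.le hyR] at hm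
      rw [div_le_iff₀ hw0] at hm
      exact hm.trans (mul_le_mul_of_nonneg_left
        ((ENNReal.ofReal_lt_iff_lt_toReal hw0.le htop₁).1 hwR).le hk0.le)
    rw [← ENNReal.toReal_lt_toReal htop htop₁]
    nlinarith
  · obtain ⟨L₁, hL₁, hL₁le⟩ :=
      hv₁.exists_tendsto_mul_abs_uderiv hp hn hK.1 hf hr₁ hR₁ hu₁.le
    refine ⟨L₁, _, hL₁, hlimw, ?_⟩
    have : L₁ + c₀ ≤ ρ * |uderiv v₂ ρ| := ge_of_tendsto hlimw <| by
      filter_upwards [hev] with x hx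
      obtain ⟨y, hy, hyR, -, h, -⟩ := hcmp x hx.1.le hx.2
      linarith [hL₁le y hy hyR]
    linarith
end
end

section
/- Assume K satisfies (K1) and that n>p>1. Then: (a) the function r ↦ r^p·K(r) is strictly increasing on (0,∞); (b) the function r ↦ K(r)^{1/p} is integrable on (0,1); (c) the function r ↦ K(r)^{1/p} is not integrable on (1,∞). -/
open Set Filter Topology MeasureTheory
open scoped ENNReal NNReal

noncomputable section

lemma hasDerivAt_rpow_mul {K : ℝ → ℝ} {r : ℝ} (a : ℝ) (hr : 0 < r) (hKr : 0 < K r)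
    (hd : DifferentiableAt ℝ K r) :
    HasDerivAt (fun x => x ^ a * K x) (r ^ (a - 1) * K r * (a + r * deriv K r / K r)) r := by
  have h := (Real.hasDerivAt_rpow_const (p := a) (Or.inl hr.ne')).mul hd.hasDerivAt
  refine h.congr_deriv ?_
  have hpow : r ^ a = r ^ (a - 1) * r := by
    rw [Real.rpow_sub_one hr.ne']
    field_simp
  rw [hpow]
  field_simp

namespace CondK1

variable {p : ℝ} {K : ℝ → ℝ}

lemma differentiableAt (hK : CondK1 p K) {r : ℝ} (hr : 0 < r) : DifferentiableAt ℝ K r :=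
  (hK.2.1.differentiableOn one_ne_zero).differentiableAt (Ioi_mem_nhds hr)

lemma continuousOn_rpow_mul (hK : CondK1 p K) (a : ℝ) :
    ContinuousOn (fun r => r ^ a * K r) (Ioi 0) := fun _ hr =>
  (hasDerivAt_rpow_mul a hr (hK.1 _ hr) (hK.differentiableAt hr)).continuousAt.continuousWithinAt

lemma strictMonoOn_rpow_mul (hK : CondK1 p K) : StrictMonoOn (fun r => r ^ p * K r) (Ioi 0) := by
  refine strictMonoOn_of_deriv_pos (convex_Ioi 0) (hK.continuousOn_rpow_mul p) fun r hr => ?_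
  rw [interior_Ioi] at hr
  have hr : 0 < r := hr
  have hKr := hK.1 r hr
  rw [(hasDerivAt_rpow_mul p hr hKr (hK.differentiableAt hr)).deriv]
  exact mul_pos (by positivity) (hK.2.2.1 r hr)

/-- Near the origin `K` is bounded by a power strictly larger than `-p`. -/
lemma exists_le_rpow (hK : CondK1 p K) :
    ∃ δ > 0, ∀ r ∈ Ioo (0 : ℝ) 1, K r ≤ K 1 * r ^ (δ - p) := by
  refine ⟨p + 1 * deriv K 1 / K 1, hK.2.2.1 1 one_pos, fun r hr => ?_⟩
  set δ := p + 1 * deriv K 1 / K 1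
  have hmono : MonotoneOn (fun x => x ^ (p - δ) * K x) (Ioc 0 1) := by
    refine monotoneOn_of_deriv_nonneg (convex_Ioc 0 1)
      ((hK.continuousOn_rpow_mul _).mono Ioc_subset_Ioi_self) ?_ fun x hx => ?_
    · intro x hx
      rw [interior_Ioc] at hx
      exact (hasDerivAt_rpow_mul _ hx.1 (hK.1 x hx.1)
        (hK.differentiableAt hx.1)).differentiableAt.differentiableWithinAt
    · rw [interior_Ioc] at hx
      have hx0 : 0 < x := hx.1
      have hKx := hK.1 x hx0
      rw [(hasDerivAt_rpow_mul _ hx0 hKx (hK.differentiableAt hx0)).deriv]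
      have h : δ ≤ p + x * deriv K x / K x :=
        hK.2.2.2 hx0 (mem_Ioi.2 one_pos) hx.2.le
      exact mul_nonneg (by positivity) (by linarith)
  have h : r ^ (p - δ) * K r ≤ K 1 := by
    simpa using hmono ⟨hr.1, hr.2.le⟩ ⟨one_pos, le_rfl⟩ hr.2.le
  rw [← neg_sub p δ, Real.rpow_neg hr.1.le, ← div_eq_mul_inv,
    le_div_iff₀ (Real.rpow_pos_of_pos hr.1 _), mul_comm]
  exact h

lemma continuousOn_rpow (hK : CondK1 p K) (a : ℝ) :
    ContinuousOn (fun r => K r ^ a) (Ioi 0) :=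
  hK.2.1.continuousOn.rpow_const fun r hr => Or.inl (hK.1 r hr).ne'

lemma integrableOn_Ioo (hK : CondK1 p K) (hp : 0 < p) :
    IntegrableOn (fun r => K r ^ (1 / p)) (Ioo 0 1) := by
  obtain ⟨δ, hδ, hle⟩ := hK.exists_le_rpow
  have hint : IntegrableOn (fun r : ℝ => K 1 ^ (1 / p) * r ^ (δ / p - 1)) (Ioo 0 1) :=
    ((intervalIntegral.integrableOn_Ioo_rpow_iff one_pos).2
      (by linarith [div_pos hδ hp])).const_mul _
  refine hint.mono' (((hK.continuousOn_rpow _).mono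
    Ioo_subset_Ioi_self).aestronglyMeasurable measurableSet_Ioo) ?_
  refine (ae_restrict_iff' measurableSet_Ioo).2 (.of_forall fun r hr => ?_)
  have hKr := hK.1 r hr.1
  rw [Real.norm_of_nonneg (by positivity)]
  calc K r ^ (1 / p) ≤ (K 1 * r ^ (δ - p)) ^ (1 / p) :=
        Real.rpow_le_rpow hKr.le (hle r hr) (by positivity)
    _ = K 1 ^ (1 / p) * r ^ (δ / p - 1) := by
        rw [Real.mul_rpow (hK.1 1 one_pos).le (Real.rpow_nonneg hr.1.le _),
          ← Real.rpow_mul hr.1.le]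
        congr 2
        field_simp

lemma not_integrableOn_Ioi (hK : CondK1 p K) (hp : 0 < p) :
    ¬ IntegrableOn (fun r => K r ^ (1 / p)) (Ioi 1) := by
  intro hint
  have hK1 := hK.1 1 one_pos
  refine not_integrableOn_Ioi_inv (a := 1) ?_
  refine (hint.const_mul (K 1 ^ (1 / p))⁻¹).mono'
    measurable_inv.aestronglyMeasurable ?_
  refine (ae_restrict_iff' measurableSet_Ioi).2 (.of_forall fun r hr => ?_)
  have hr0 : 0 < r := one_pos.trans hr
  have hKr := hK.1 r hr0
  have h : K 1 ≤ r ^ p * K r := by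
    simpa using (hK.strictMonoOn_rpow_mul (mem_Ioi.2 one_pos) (mem_Ioi.2 hr0) hr).le
  have h' : K 1 ^ (1 / p) ≤ r * K r ^ (1 / p) := by
    refine (Real.rpow_le_rpow hK1.le h (by positivity : 0 ≤ 1 / p)).trans_eq ?_
    rw [Real.mul_rpow (by positivity) hKr.le, ← Real.rpow_mul hr0.le,
      mul_one_div_cancel hp.ne', Real.rpow_one]
  rw [Real.norm_of_nonneg (by positivity), inv_mul_eq_div,
    le_div_iff₀ (by positivity), inv_mul_le_iff₀ hr0]
  exact h'

end CondK1

/-- Under (K1) and `n>p>1`: `r^p K(r)` is strictly increasing, `K^{1/p}` is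
integrable near `0` and not integrable near `∞`. -/
theorem rpK_strictMono_and_K_integrability
    (p : ℝ) (n : ℕ) (hp : 1 < p) (hn : p < n)
    (K : ℝ → ℝ) (hK : CondK1 p K) :
    StrictMonoOn (fun r => r ^ p * K r) (Ioi 0) ∧
    IntegrableOn (fun r => K r ^ (1 / p)) (Ioo 0 1) volume ∧
    ¬ IntegrableOn (fun r => K r ^ (1 / p)) (Ioi 1) volume :=
  ⟨hK.strictMonoOn_rpow_mul, hK.integrableOn_Ioo (one_pos.trans hp),
    hK.not_integrableOn_Ioi (one_pos.trans hp)⟩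
end
end
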